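/- arXiv:1801.02405 — 2 statements merged into one kernel-verified Lean document; each statement's English description precedes it below -/
import Mathlib

section
/- Let G be a connected, locally finite, infinite graph with infinite motion. If there exist ε > 0 and a vertex v of G such that |S_v(n)| ≤ 2n(1−ε)/3 for infinitely many n ∈ ℕ, then G admits a distinguishing 2-coloring one of whose color classes W satisfies δ_x(W) = 0 for every vertex x; in particular the distinguishing number of G is 2 and G has 2-distinguishing density zero. -/
open Filter SimpleGraph

/-- The ball of radius `n` around `v`: all vertices at distance at most `n` from `v`. -/
def gball {V : Type*} (G : SimpleGraph V) (v : V) (n : ℕ) : Set V :=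
  {x | G.dist v x ≤ n}

/-- The sphere of radius `n` around `v`: all vertices at distance exactly `n` from `v`. -/
def gsphere {V : Type*} (G : SimpleGraph V) (v : V) (n : ℕ) : Set V :=
  {x | G.dist v x = n}

/-- A 2-coloring (vertices colored by `Bool`) is distinguishing if the identity is the
only automorphism preserving it. -/
def Distinguishing {V : Type*} (G : SimpleGraph V) (l : V → Bool) : Prop :=
  ∀ g : G ≃g G, (∀ x, l (g x) = l x) → ∀ x, g x = x

/-- The set `W` has density zero at `v`:
`|B_v(n) ∩ W| / |B_v(n)| → 0` as `n → ∞`. -/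
def DensityZeroAt {V : Type*} (G : SimpleGraph V) (W : Set V) (v : V) : Prop :=
  Tendsto (fun n : ℕ => ((gball G v n ∩ W).ncard : ℝ) / ((gball G v n).ncard : ℝ))
    atTop (nhds 0)

/-- A graph has infinite motion if every nontrivial automorphism moves infinitely many
vertices. -/
def InfiniteMotion {V : Type*} (G : SimpleGraph V) : Prop :=
  ∀ g : G ≃g G, (∃ x, g x ≠ x) → {x : V | g x ≠ x}.Infinite

/-- The permutations preserving a set `A`, i.e. its setwise stabilizer. -/
def presSub {X : Type*} (A : Set X) : Subgroup (Equiv.Perm X) where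
  carrier := {g | ∀ x, g x ∈ A ↔ x ∈ A}
  one_mem' := fun _ => Iff.rfl
  mul_mem' := by
    intro a b ha hb x
    rw [Equiv.Perm.mul_apply, ha, hb]
  inv_mem' := by
    intro a ha x
    rw [← ha (a⁻¹ x)]
    simp

/-- Orbit-stabilizer inside a subgroup of a symmetric group. -/
theorem card_orbit_mul_card_inf_stabilizer {X : Type*} [Finite X]
    (N : Subgroup (Equiv.Perm X)) (x : X) :
    Nat.card (MulAction.orbit N x) *
      Nat.card ↥(N ⊓ MulAction.stabilizer (Equiv.Perm X) x) = Nat.card N := by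
  have h1 := MulAction.index_stabilizer N x
  have h2 : MulAction.stabilizer N x = (MulAction.stabilizer (Equiv.Perm X) x).subgroupOf N := by
    ext g; simp [MulAction.mem_stabilizer_iff, Subgroup.mem_subgroupOf]; rfl
  have h3 := (MulAction.stabilizer N x).index_mul_card
  rw [h1] at h3
  rw [← h3]
  congr 1
  rw [h2, ← Subgroup.inf_subgroupOf_left]
  exact Nat.card_congr (Subgroup.subgroupOfEquivOfLe inf_le_left).symm.toEquiv

theorem exists_small_base {X : Type*} [Finite X] :
    ∀ (n : ℕ) (N : Subgroup (Equiv.Perm X)), Nat.card N ≤ n →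
      ∃ Y : Finset X, 2 ^ Y.card ≤ Nat.card N ∧ ∀ g ∈ N, (∀ x ∈ Y, g x = x) → g = 1 := by
  classical
  intro n
  induction n with
  | zero =>
    intro N hN
    have := Nat.card_pos (α := N)
    omega
  | succ n ih =>
    intro N hN
    by_cases h1 : ∀ g ∈ N, g = 1
    · exact ⟨∅, Nat.card_pos (α := N), fun g hg _ => h1 g hg⟩
    · push Not at h1
      obtain ⟨g, hg, hg1⟩ := h1
      obtain ⟨x, hx⟩ : ∃ x, g x ≠ x := by
        by_contra! h
        exact hg1 (Equiv.ext h)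
      have hc := card_orbit_mul_card_inf_stabilizer N x
      have h2 : 2 ≤ Nat.card (MulAction.orbit N x) := by
        have : 1 < Nat.card (MulAction.orbit N x) := by
          rw [Finite.one_lt_card_iff_nontrivial]
          refine ⟨⟨x, MulAction.mem_orbit_self x⟩, ⟨g x, ⟨⟨g, hg⟩, rfl⟩⟩, ?_⟩
          intro h
          exact hx (congrArg Subtype.val h).symm
        exact this
      have hp : 0 < Nat.card ↥(N ⊓ MulAction.stabilizer (Equiv.Perm X) x) := Nat.card_pos
      obtain ⟨Y, hY, hY'⟩ := ih (N ⊓ MulAction.stabilizer (Equiv.Perm X) x) (by nlinarith)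
      refine ⟨insert x Y, ?_, ?_⟩
      · calc 2 ^ (insert x Y).card ≤ 2 ^ (Y.card + 1) :=
              Nat.pow_le_pow_right (by norm_num) (Finset.card_insert_le _ _)
          _ = 2 * 2 ^ Y.card := by ring
          _ ≤ _ := by rw [← hc]; exact Nat.mul_le_mul h2 hY
      · intro h hh hfix
        exact hY' h ⟨hh, hfix x (Finset.mem_insert_self _ _)⟩
          fun y hy => hfix y (Finset.mem_insert_of_mem hy)

/-- A permutation group of order at most `k!` has a distinguishing colouring with `k` colours
which is nonzero on few points only. -/
theorem exists_distinguishing_colors {X : Type*} [Finite X] :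
    ∀ (k : ℕ) (N : Subgroup (Equiv.Perm X)), Nat.card N ≤ k.factorial →
      ∃ (Y : Finset X) (c : X → ℕ), 2 ^ Y.card ≤ Nat.card N ∧ (∀ x, x ∉ Y → c x = 0) ∧
        (∀ x, c x < k ∨ c x = 0) ∧ ∀ g ∈ N, (∀ x, c (g x) = c x) → g = 1 := by
  classical
  have triv : ∀ N : Subgroup (Equiv.Perm X), Nat.card N ≤ 1 → ∀ k : ℕ,
      ∃ (Y : Finset X) (c : X → ℕ), 2 ^ Y.card ≤ Nat.card N ∧ (∀ x, x ∉ Y → c x = 0) ∧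
        (∀ x, c x < k ∨ c x = 0) ∧ ∀ g ∈ N, (∀ x, c (g x) = c x) → g = 1 := by
    intro N hN k
    refine ⟨∅, fun _ => 0, Nat.card_pos (α := N), by simp, by simp, ?_⟩
    intro g hg _
    have := Subgroup.card_le_one_iff_eq_bot (H := N)
    rw [this] at hN
    rw [hN] at hg
    simpa using hg
  intro k
  induction k with
  | zero => intro N hN; exact triv N (by simpa using hN) 0
  | succ k ih =>
    intro N hN
    by_cases hk : k = 0
    · subst hk; exact triv N (by simpa using hN) 1
    by_cases horb : ∃ x : X, k + 1 ≤ Nat.card (MulAction.orbit N x)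
    · obtain ⟨x, hx⟩ := horb
      have hc := card_orbit_mul_card_inf_stabilizer N x
      have hle : Nat.card ↥(N ⊓ MulAction.stabilizer (Equiv.Perm X) x) ≤ k.factorial := by
        rw [Nat.factorial_succ] at hN
        by_contra! h
        have := Nat.mul_lt_mul_of_le_of_lt hx h (by omega)
        omega
      obtain ⟨Y, c, hY, hc0, hck, hcd⟩ := ih _ hle
      have hck' : ∀ y, c y < k := by
        intro y
        rcases hck y with h | h <;> omega
      refine ⟨insert x Y, Function.update c x k, ?_, ?_, ?_, ?_⟩
      · calc 2 ^ (insert x Y).card ≤ 2 ^ (Y.card + 1) :=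
              Nat.pow_le_pow_right (by norm_num) (Finset.card_insert_le _ _)
          _ = 2 * 2 ^ Y.card := by ring
          _ ≤ _ := by rw [← hc]; exact Nat.mul_le_mul (by omega) hY
      · intro y hy
        rw [Finset.mem_insert, not_or] at hy
        rw [Function.update_of_ne hy.1]
        exact hc0 y hy.2
      · intro y
        left
        by_cases hyx : y = x
        · subst hyx; simp
        · rw [Function.update_of_ne hyx]
          have := hck' y
          omega
      · intro g hg hpres
        have hgx : g x = x := by
          by_contra hne
          have := hpres x
          rw [Function.update_of_ne hne, Function.update_self] at this
          have := hck' (g x)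
          omega
        refine hcd g ⟨hg, hgx⟩ ?_
        intro y
        by_cases hyx : y = x
        · subst hyx; rw [hgx]
        · have h1 : g y ≠ x := fun h => hyx (g.injective (h.trans hgx.symm))
          have := hpres y
          rwa [Function.update_of_ne h1, Function.update_of_ne hyx] at this
    · push Not at horb
      obtain ⟨Y, hY, hbase⟩ := exists_small_base _ N le_rfl
      have hemb : ∀ o : MulAction.orbitRel.Quotient N X, ∃ f : X → ℕ,
          (∀ y, f y < k) ∧
            ∀ y z, Quotient.mk'' y = o → Quotient.mk'' z = o → f y = f z → y = z := by
        intro o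
        induction o using Quotient.inductionOn' with
        | h x =>
        have := horb x
        let e := Finite.equivFin (MulAction.orbit N x)
        refine ⟨fun y => if h : y ∈ MulAction.orbit N x then e ⟨y, h⟩ else 0, ?_, ?_⟩
        · intro y
          by_cases h : y ∈ MulAction.orbit N x
          · simp only [h, dif_pos]; have := (e ⟨y, h⟩).2; omega
          · simp only [h, dif_neg, not_false_eq_true]; omega
        · intro y z hy hz hyz
          have hy' : y ∈ MulAction.orbit N x := MulAction.orbitRel_apply.1 (Quotient.eq''.1 hy)
          have hz' : z ∈ MulAction.orbit N x := MulAction.orbitRel_apply.1 (Quotient.eq''.1 hz)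
          simp only [hy', hz', dif_pos] at hyz
          have := e.injective (Fin.ext hyz)
          exact congrArg Subtype.val this
      choose f hf1 hf2 using hemb
      refine ⟨Y, fun x => if x ∈ Y then f (Quotient.mk'' x) x + 1 else 0, hY, ?_, ?_, ?_⟩
      · intro x hx; simp [hx]
      · intro x
        by_cases hx : x ∈ Y
        · left; simp only [hx, if_true]; have := hf1 (Quotient.mk'' x) x; omega
        · right; simp [hx]
      · intro g hg hpres
        refine hbase g hg ?_
        intro x hx
        have := hpres x
        simp only [hx, if_true] at this
        by_cases hgx : g x ∈ Y
        · simp only [hgx, if_true] at this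
          have ho : (Quotient.mk'' (g x) : MulAction.orbitRel.Quotient N X) = Quotient.mk'' x :=
            Quotient.eq''.2 (MulAction.orbitRel_apply.2 ⟨⟨g, hg⟩, rfl⟩)
          rw [ho] at this
          exact hf2 _ _ _ ho rfl (by omega)
        · simp [hgx] at this

/-- A permutation group of order at most `(2 ^ b)!` has a small set whose stabilizer has
large index. -/
theorem exists_set_large_index {X : Type*} [Finite X] (N : Subgroup (Equiv.Perm X)) (k b : ℕ)
    (hN : Nat.card N ≤ k.factorial) (hk : k ≤ 2 ^ b) (hb : b ≠ 0) :
    ∃ Y : Finset X, 2 ^ Y.card ≤ Nat.card N ∧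
      Nat.card N ≤ ((presSub (Y : Set X)).relIndex N) ^ b := by
  classical
  obtain ⟨Y, c, hY, hc0, hck, hcd⟩ := exists_distinguishing_colors k N hN
  let Z : Fin b → Finset X := fun i => Y.filter fun x => (c x).testBit i
  have hlt : ∀ x, c x < 2 ^ b := by
    intro x
    have := Nat.two_pow_pos b
    rcases hck x with h | h <;> omega
  have hZmem : ∀ i x, x ∈ Z i ↔ (c x).testBit i := by
    intro i x
    simp only [Z, Finset.mem_filter, and_iff_right_iff_imp]
    intro h
    by_contra hx
    simp [hc0 x hx] at h
  have hinf : (⨅ i, (presSub (Z i : Set X)).subgroupOf N) = ⊥ := by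
    rw [eq_bot_iff]
    intro g hg
    rw [Subgroup.mem_iInf] at hg
    rw [Subgroup.mem_bot]
    ext1
    refine hcd g g.2 ?_
    intro x
    apply Nat.eq_of_testBit_eq
    intro i
    by_cases hi : i < b
    · have := hg ⟨i, hi⟩ x
      simp only [Finset.mem_coe, hZmem] at this
      exact Bool.eq_iff_iff.2 this
    · have hpow : 2 ^ b ≤ 2 ^ i := Nat.pow_le_pow_right (by norm_num) (by omega)
      rw [Nat.testBit_lt_two_pow ((hlt _).trans_le hpow),
        Nat.testBit_lt_two_pow ((hlt _).trans_le hpow)]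
  have hidx := Subgroup.index_iInf_le fun i => (presSub (Z i : Set X)).subgroupOf N
  rw [hinf, Subgroup.index_bot] at hidx
  obtain ⟨i, -, hi⟩ := Finset.exists_max_image (Finset.univ : Finset (Fin b))
    (fun i => ((presSub (Z i : Set X)).subgroupOf N).index) ⟨⟨0, by omega⟩, Finset.mem_univ _⟩
  refine ⟨Z i, ?_, ?_⟩
  · exact (Nat.pow_le_pow_right (by norm_num) (Finset.card_filter_le _ _)).trans hY
  · refine hidx.trans ?_
    refine (Finset.prod_le_pow_card _ _ _ hi).trans ?_
    simp [Subgroup.relIndex]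

/-- The permutation representation of a group on an invariant subset. -/
def restrHom {A X : Type*} [Group A] [MulAction A X] (p : X → Prop)
    (h : ∀ (a : A) x, p (a • x) ↔ p x) : A →* Equiv.Perm {x // p x} :=
  MonoidHom.mk' (fun a => (MulAction.toPerm a).subtypePerm (h a)) (by
    intro a b
    ext x
    exact mul_smul a b (x : X))

@[simp]
theorem restrHom_apply_coe {A X : Type*} [Group A] [MulAction A X] (p : X → Prop)
    (h : ∀ (a : A) x, p (a • x) ↔ p x) (a : A) (x : {x // p x}) :
    (restrHom p h a x : X) = a • (x : X) := rfl

theorem mem_ker_restrHom {A X : Type*} [Group A] [MulAction A X] (p : X → Prop)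
    (h : ∀ (a : A) x, p (a • x) ↔ p x) (a : A) :
    a ∈ (restrHom p h).ker ↔ ∀ x, p x → a • x = x := by
  rw [MonoidHom.mem_ker, Equiv.ext_iff]
  simp [Subtype.forall, Subtype.ext_iff]

theorem relIndex_dvd_of_le_right {A : Type*} [Group A] (K : Subgroup A) [K.Normal]
    {H' H : Subgroup A} (h : H' ≤ H) : K.relIndex H' ∣ K.relIndex H := by
  rw [← Subgroup.relIndex_subgroupOf h]
  exact Subgroup.relIndex_dvd_index_of_normal _ _

/-- An abelian permutation group has a small set with trivial setwise stabilizer. -/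
theorem exists_set_of_comm {X : Type*} [Finite X] (N : Subgroup (Equiv.Perm X))
    (hcomm : ∀ a ∈ N, ∀ b ∈ N, a * b = b * a) :
    ∃ Y : Finset X, 2 ^ Y.card ≤ Nat.card N ∧ ∀ g ∈ N, g ∈ presSub (Y : Set X) → g = 1 := by
  classical
  obtain ⟨Y₀, hY₀, hb₀⟩ := exists_small_base _ N le_rfl
  obtain ⟨Y, hb, hmin⟩ : ∃ Y : Finset X, (∀ g ∈ N, (∀ x ∈ Y, g x = x) → g = 1) ∧
      ∀ Z : Finset X, (∀ g ∈ N, (∀ x ∈ Z, g x = x) → g = 1) → Y.card ≤ Z.card := by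
    have hex : ∃ n, ∃ Y : Finset X, (∀ g ∈ N, (∀ x ∈ Y, g x = x) → g = 1) ∧ Y.card = n :=
      ⟨_, Y₀, hb₀, rfl⟩
    obtain ⟨Y, hY, hn⟩ := Nat.find_spec hex
    exact ⟨Y, hY, fun Z hZ => hn.le.trans (Nat.find_min' hex ⟨Z, hZ, rfl⟩)⟩
  refine ⟨Y, (Nat.pow_le_pow_right (by norm_num) (hmin Y₀ hb₀)).trans hY₀, ?_⟩
  intro g hg hpres
  refine hb g hg ?_
  intro x hx
  by_contra hne
  have hgx : g x ∈ Y := (hpres x).2 hx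
  have : Y.card ≤ (Y.erase (g x)).card := by
    refine hmin _ ?_
    intro h hh hfix
    refine hb h hh ?_
    intro y hy
    by_cases hyg : y = g x
    · subst hyg
      have h1 : h x = x := hfix x (Finset.mem_erase.2 ⟨fun h => hne h.symm, hx⟩)
      have h2 := congrArg (fun f : Equiv.Perm X => f x) (hcomm h hh g hg)
      simp only [Equiv.Perm.mul_apply, h1] at h2
      exact h2
    · exact hfix y (Finset.mem_erase.2 ⟨hyg, hy⟩)
  rw [Finset.card_erase_of_mem hgx] at this
  have := Finset.card_pos.2 ⟨_, hgx⟩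
  omega

/-- `BreakCost β s g` says that every permutation group whose order divides `g` can be broken
in at most `s` rounds, each round fixing a set by an argument using at most `β` bits. -/
def BreakCost (β : ℕ) : ℕ → ℕ → Prop
  | 0, g => g = 1
  | s + 1, g => ∀ d, d ∣ g → d = 1 ∨ (∃ p, p.Prime ∧ (d = p ∨ d = p ^ 2)) ∨
      ∃ b k, b ≠ 0 ∧ b ≤ β ∧ d ≤ k.factorial ∧ k ≤ 2 ^ b ∧
        ∀ e, e ∣ d → e ^ b ≤ d ^ (b - 1) → BreakCost β s e

theorem BreakCost.one {β : ℕ} : ∀ s, BreakCost β s 1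
  | 0 => rfl
  | _ + 1 => fun _ hd => Or.inl (Nat.dvd_one.1 hd)

theorem BreakCost.of_dvd {β s d g : ℕ} (h : BreakCost β s g) (hd : d ∣ g) : BreakCost β s d := by
  cases s with
  | zero =>
    have : g = 1 := h
    subst this
    exact Nat.dvd_one.1 hd
  | succ s => exact fun e he => h e (he.trans hd)

/-- One round: a permutation group of order `d ≠ 1` with `BreakCost β (s + 1) d` has a small set
whose stabilizer has smaller cost. -/
theorem BreakCost.exists_set {X : Type*} [Finite X] {β s : ℕ} (hβ : β ≠ 0)
    (N : Subgroup (Equiv.Perm X))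
    (hN : BreakCost β s (Nat.card N)) (h1 : Nat.card N ≠ 1) :
    s ≠ 0 ∧ ∃ Y : Finset X, 2 ^ Y.card ≤ ((presSub (Y : Set X)).relIndex N) ^ β ∧
      BreakCost β (s - 1) (Nat.card ↥(N ⊓ presSub (Y : Set X))) := by
  cases s with
  | zero => exact absurd hN h1
  | succ s =>
  refine ⟨Nat.succ_ne_zero _, ?_⟩
  rw [Nat.add_sub_cancel]
  have hpos : ∀ M : Subgroup (Equiv.Perm X), 0 < M.relIndex N := fun M =>
    Nat.pos_of_ne_zero Subgroup.index_ne_zero_of_finite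
  rcases hN _ dvd_rfl with h | ⟨p, hp, h⟩ | ⟨b, k, hb0, hbβ, hk, hkb, h⟩
  · exact absurd h h1
  · have hcomm : IsMulCommutative N := by
      have := Fact.mk hp
      rcases h with h | h
      · have := isCyclic_of_prime_card h
        infer_instance
      · exact IsPGroup.isMulCommutative_of_card_eq_prime_sq h
    obtain ⟨Y, hY, hYs⟩ := exists_set_of_comm N (fun a ha b hb =>
      congrArg Subtype.val (hcomm.is_comm.comm ⟨a, ha⟩ ⟨b, hb⟩))
    have hbot : presSub (Y : Set X) ⊓ N = ⊥ := by
      rw [eq_bot_iff]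
      intro g hg
      exact hYs g hg.2 hg.1
    refine ⟨Y, ?_, ?_⟩
    · rw [← Subgroup.inf_relIndex_right, hbot, Subgroup.relIndex_bot_left]
      exact hY.trans (Nat.le_self_pow hβ _)
    · rw [inf_comm, hbot, Subgroup.card_bot]
      exact BreakCost.one s
  · obtain ⟨Y, hY, hYs⟩ := exists_set_large_index N k b hk hkb hb0
    refine ⟨Y, hY.trans (hYs.trans (Nat.pow_le_pow_right (hpos _) hbβ)), ?_⟩
    have hmul : Nat.card ↥(N ⊓ presSub (Y : Set X)) * (presSub (Y : Set X)).relIndex N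
        = Nat.card N := by
      have := Subgroup.relIndex_mul_relIndex ⊥ (N ⊓ presSub (Y : Set X)) N bot_le inf_le_left
      rwa [Subgroup.relIndex_bot_left, Subgroup.relIndex_bot_left,
        Subgroup.inf_relIndex_left] at this
    refine h _ (Dvd.intro _ hmul) ?_
    have hd : 0 < Nat.card N := Nat.card_pos
    refine Nat.le_of_mul_le_mul_right ?_ hd
    calc _ ≤ Nat.card ↥(N ⊓ presSub (Y : Set X)) ^ b * (presSub (Y : Set X)).relIndex N ^ b :=
          Nat.mul_le_mul_left _ hYs
      _ = Nat.card N ^ b := by rw [← mul_pow, hmul]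
      _ = Nat.card N ^ (b - 1) * Nat.card N := by
          rw [← pow_succ, Nat.sub_add_cancel (Nat.pos_of_ne_zero hb0)]

/-- The multi-round game: if there are more rounds than the total cost of the chain, some
round is won. -/
theorem exists_sets_of_chain {A X : Type*} [Group A] [Finite A] [MulAction A X] [Finite X]
    {β r : ℕ} (hβ : β ≠ 0) (L : ℕ → Subgroup A) (hLn : ∀ i, (L i).Normal) (hLm : Monotone L)
    (hLr : L r = ⊤)
    (S : ℕ → Set X) (hS : ∀ t (a : A) x, a • x ∈ S t ↔ x ∈ S t) (T : Finset ℕ) :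
    ∀ (H : Subgroup A) (s : ℕ → ℕ),
    (∀ t ∈ T, ∃ c, fixingSubgroup A (S t) = L c) →
    (∀ j < r, BreakCost β (s j) ((L j).relIndex (H ⊓ L (j + 1)))) →
    ∑ j ∈ Finset.range r, s j < T.card →
    ∃ Y : ℕ → Finset X, (∀ t, (Y t : Set X) ⊆ S t) ∧
      2 ^ (∑ t ∈ T, (Y t).card) ≤ Nat.card H ^ β ∧
      ∃ t ∈ T, ∀ a ∈ H, (∀ u ∈ T, ∀ x, a • x ∈ Y u ↔ x ∈ Y u) → ∀ x ∈ S t, a • x = x := by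
  classical
  induction T using Finset.induction with
  | empty => intro H s _ _ h; simp at h
  | insert t T ht ih =>
  intro H s hK hs hsum
  by_cases hH : H ≤ fixingSubgroup A (S t)
  · refine ⟨fun _ => ∅, by simp, by simpa using Nat.one_le_pow _ _ Nat.card_pos, t,
      Finset.mem_insert_self _ _, ?_⟩
    intro a ha _ x hx
    exact (mem_fixingSubgroup_iff A).1 (hH ha) x hx
  obtain ⟨c, hc⟩ := hK t (Finset.mem_insert_self _ _)
  have hex : ∃ j, ¬ (H ⊓ L j ≤ fixingSubgroup A (S t)) := ⟨r, by rwa [hLr, inf_top_eq]⟩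
  obtain ⟨j, hjr, hj, hjmin⟩ : ∃ j ≤ r, ¬ (H ⊓ L j ≤ fixingSubgroup A (S t)) ∧
      ∀ i < j, H ⊓ L i ≤ fixingSubgroup A (S t) :=
    ⟨Nat.find hex, Nat.find_min' hex (by rwa [hLr, inf_top_eq]), Nat.find_spec hex,
      fun i hi => not_not.1 (Nat.find_min hex hi)⟩
  have hcj : c < j := by
    by_contra! h
    exact hj (inf_le_right.trans (hc ▸ hLm h))
  obtain ⟨i, rfl⟩ : ∃ i, j = i + 1 := ⟨j - 1, by omega⟩
  have hφ := mem_ker_restrHom (· ∈ S t) (hS t)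
  set φ := restrHom (· ∈ S t) (hS t) with hφdef
  have hker : φ.ker = fixingSubgroup A (S t) := by
    ext a
    rw [hφ, mem_fixingSubgroup_iff]
  have hkerc : φ.ker = L c := hker.trans hc
  -- On subgroups of `H ⊓ L (i + 1)`, the kernel of `φ` agrees with `L i`.
  have hrel : ∀ M : Subgroup A, M ≤ H → (L i).relIndex (M ⊓ L (i + 1)) =
      Nat.card ((M ⊓ L (i + 1)).map φ) := by
    intro M hM
    rw [← Subgroup.relIndex_ker, ← Subgroup.inf_relIndex_right (L i),
      ← Subgroup.inf_relIndex_right φ.ker]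
    congr 1
    apply le_antisymm
    · refine le_inf ?_ inf_le_right
      rw [hker]
      exact le_trans (le_inf (inf_le_right.trans (inf_le_left.trans hM)) inf_le_left)
        (hjmin i (Nat.lt_succ_self i))
    · exact inf_le_inf_right _ (hkerc ▸ hLm (Nat.lt_succ_iff.1 hcj))
  have hir : i < r := hjr
  obtain ⟨hs0, Y, hY, hYs⟩ := BreakCost.exists_set hβ ((H ⊓ L (i + 1)).map φ)
    (hrel H le_rfl ▸ hs i hir) (by
      intro h1
      rw [← Subgroup.relIndex_ker, Subgroup.relIndex_eq_one, hker] at h1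
      exact hj h1)
  let H' : Subgroup A := H ⊓ (presSub (Y : Set {x // x ∈ S t})).comap φ
  have hH'H : H' ≤ H := inf_le_left
  obtain ⟨Z, hZS, hZc, u, hu, hZu⟩ := ih H' (Function.update s i (s i - 1))
    (fun t ht => hK t (Finset.mem_insert_of_mem ht)) (by
      intro k hk
      by_cases hki : k = i
      · subst hki
        rw [Function.update_self, hrel H' hH'H]
        have heq : (H' ⊓ L (k + 1)).map φ =
            (H ⊓ L (k + 1)).map φ ⊓ presSub (Y : Set {x // x ∈ S t}) := by
          ext f
          simp only [Subgroup.mem_map, Subgroup.mem_inf, Subgroup.mem_comap, H']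
          constructor
          · rintro ⟨x, ⟨⟨h1, h2⟩, h3⟩, rfl⟩
            exact ⟨⟨x, ⟨h1, h3⟩, rfl⟩, h2⟩
          · rintro ⟨⟨x, ⟨h1, h3⟩, rfl⟩, h2⟩
            exact ⟨x, ⟨⟨h1, h2⟩, h3⟩, rfl⟩
        rwa [heq]
      · rw [Function.update_of_ne hki]
        have := hLn k
        exact (hs k hk).of_dvd (relIndex_dvd_of_le_right _ (inf_le_inf_right _ hH'H))) (by
      rw [Finset.card_insert_of_notMem ht] at hsum
      rw [← Finset.add_sum_erase _ _ (Finset.mem_range.2 hir)] at hsum ⊢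
      rw [Function.update_self, Finset.sum_congr rfl fun k hk =>
        Function.update_of_ne (Finset.ne_of_mem_erase hk) _ _]
      omega)
  have hne : ∀ w ∈ T, w ≠ t := fun w hw h => ht (h ▸ hw)
  refine ⟨Function.update Z t (Y.map (Function.Embedding.subtype _)), ?_, ?_, u,
    Finset.mem_insert_of_mem hu, ?_⟩
  · intro w
    by_cases hw : w = t
    · subst hw
      rw [Function.update_self]
      intro x hx
      simp only [Finset.coe_map, Function.Embedding.subtype_apply, Set.mem_image] at hx
      obtain ⟨y, -, rfl⟩ := hx
      exact y.2
    · rw [Function.update_of_ne hw]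
      exact hZS w
  · rw [Finset.sum_insert ht, Function.update_self, Finset.card_map,
      Finset.sum_congr rfl fun w hw => by rw [Function.update_of_ne (hne w hw)], pow_add]
    have h1 : Nat.card H' * ((presSub (Y : Set {x // x ∈ S t})).relIndex
        ((H ⊓ L (i + 1)).map φ)) ≤ Nat.card H := by
      have h2 := Subgroup.relIndex_mul_relIndex ⊥ H' H bot_le hH'H
      rw [Subgroup.relIndex_bot_left, Subgroup.relIndex_bot_left, Subgroup.inf_relIndex_left,
        Subgroup.relIndex_comap] at h2
      rw [← h2]
      refine Nat.mul_le_mul_left _ (Subgroup.relIndex_le_of_le_right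
        (Subgroup.map_mono inf_le_left) Subgroup.index_ne_zero_of_finite)
    calc _ ≤ _ := Nat.mul_le_mul hY hZc
      _ = (Nat.card H' * _) ^ β := by rw [mul_comm, mul_pow]
      _ ≤ _ := Nat.pow_le_pow_left h1 β
  · intro a ha hpres
    refine hZu a ⟨ha, ?_⟩ ?_
    · intro x
      have := hpres t (Finset.mem_insert_self _ _) x
      have hm : ∀ y : {x // x ∈ S t},
          (y : X) ∈ Y.map (Function.Embedding.subtype _) ↔ y ∈ Y := by
        intro y
        rw [Finset.mem_map]
        exact ⟨fun ⟨z, hz, hzy⟩ => Subtype.ext hzy ▸ hz, fun hy => ⟨y, hy, rfl⟩⟩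
      rwa [Function.update_self, ← restrHom_apply_coe _ (hS t) a x, hm, hm] at this
    · intro w hw x
      have := hpres w (Finset.mem_insert_of_mem hw) x
      rwa [Function.update_of_ne (hne w hw)] at this

theorem BreakCost.of_le_step {β s T T' b k : ℕ}
    (h : ∀ g, 0 < g → g ≤ T → BreakCost β s g) (hb : b ≠ 0) (hbβ : b ≤ β)
    (hT' : T' ≤ k.factorial) (hk : k ≤ 2 ^ b) (hlt : T' ^ (b - 1) < (T + 1) ^ b) :
    ∀ g, 0 < g → g ≤ T' → BreakCost β (s + 1) g := by
  intro g hg hgT d hd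
  have hdg := Nat.le_of_dvd hg hd
  refine Or.inr (Or.inr ⟨b, k, hb, hbβ, (hdg.trans hgT).trans hT', hk, ?_⟩)
  intro e he hle
  refine h e (Nat.pos_of_dvd_of_pos he (Nat.pos_of_dvd_of_pos hd hg)) ?_
  by_contra! hlt'
  have h1 : (T + 1) ^ b ≤ e ^ b := Nat.pow_le_pow_left hlt' b
  have h2 : d ^ (b - 1) ≤ T' ^ (b - 1) := Nat.pow_le_pow_left (hdg.trans hgT) _
  omega

theorem breakCost_one {β : ℕ} : ∀ g, 0 < g → g ≤ 5 → BreakCost β 1 g := by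
  intro g hg hg5 d hd
  have hd5 := (Nat.le_of_dvd hg hd).trans hg5
  have hd0 := Nat.pos_of_dvd_of_pos hd hg
  have h2 : Nat.Prime 2 := by norm_num
  have h3 : Nat.Prime 3 := by norm_num
  have h5 : Nat.Prime 5 := by norm_num
  interval_cases d
  · exact Or.inl rfl
  · exact Or.inr (Or.inl ⟨2, h2, Or.inl rfl⟩)
  · exact Or.inr (Or.inl ⟨3, h3, Or.inl rfl⟩)
  · exact Or.inr (Or.inl ⟨2, h2, Or.inr rfl⟩)
  · exact Or.inr (Or.inl ⟨5, h5, Or.inl rfl⟩)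

theorem breakCost_two {β : ℕ} (hβ : 5 ≤ β) : ∀ g, 0 < g → g ≤ 24 → BreakCost β 2 g :=
  BreakCost.of_le_step (b := 2) (k := 4) breakCost_one (by norm_num) (by omega) (by decide)
    (by norm_num) (by norm_num)

theorem breakCost_three {β : ℕ} (hβ : 5 ≤ β) : ∀ g, 0 < g → g ≤ 124 → BreakCost β 3 g :=
  BreakCost.of_le_step (b := 3) (k := 8) (breakCost_two hβ) (by norm_num) (by omega) (by decide)
    (by norm_num) (by norm_num)

theorem breakCost_four {β : ℕ} (hβ : 5 ≤ β) : ∀ g, 0 < g → g ≤ 1397 → BreakCost β 4 g :=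
  BreakCost.of_le_step (b := 3) (k := 8) (breakCost_three hβ) (by norm_num) (by omega) (by decide)
    (by norm_num) (by norm_num)

theorem breakCost_five {β : ℕ} (hβ : 5 ≤ β) : ∀ g, 0 < g → g ≤ 40320 → BreakCost β 5 g :=
  BreakCost.of_le_step (b := 3) (k := 8) (breakCost_four hβ) (by norm_num) (by omega) (by decide)
    (by norm_num) (by norm_num)

theorem breakCost_six {β : ℕ} (hβ : 5 ≤ β) : ∀ g, 0 < g → g ≤ 1382637 → BreakCost β 6 g :=
  BreakCost.of_le_step (b := 4) (k := 16) (breakCost_five hβ) (by norm_num) (by omega) (by decide)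
    (by norm_num) (by norm_num)

theorem breakCost_seven {β : ℕ} (hβ : 5 ≤ β) : ∀ g, 0 < g → g ≤ 154032129 → BreakCost β 7 g :=
  BreakCost.of_le_step (b := 4) (k := 16) (breakCost_six hβ) (by norm_num) (by omega) (by decide)
    (by norm_num) (by norm_num)

theorem breakCost_eight {β : ℕ} (hβ : 5 ≤ β) : ∀ g, 0 < g → g ≤ 82568633031 → BreakCost β 8 g :=
  BreakCost.of_le_step (b := 4) (k := 16) (breakCost_seven hβ) (by norm_num) (by omega) (by decide)
    (by norm_num) (by norm_num)

theorem breakCost_nine {β : ℕ} (hβ : 5 ≤ β) : ∀ g, 0 < g → g ≤ 44260760146320 → BreakCost β 9 g :=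
  BreakCost.of_le_step (b := 5) (k := 32) (breakCost_eight hβ) (by norm_num) (by omega) (by decide)
    (by norm_num) (by norm_num)

theorem breakCost_ten {β : ℕ} (hβ : 5 ≤ β) :
    ∀ g, 0 < g → g ≤ 114162530171420143 → BreakCost β 10 g :=
  BreakCost.of_le_step (b := 5) (k := 32) (breakCost_nine hβ) (by norm_num) (by omega) (by decide)
    (by norm_num) (by norm_num)

theorem breakCost_eleven {β : ℕ} (hβ : 5 ≤ β) :
    ∀ g, 0 < g → g ≤ 2098478296061558882172 → BreakCost β 11 g :=
  BreakCost.of_le_step (b := 5) (k := 32) (breakCost_ten hβ) (by norm_num) (by omega) (by decide)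
    (by norm_num) (by norm_num)

theorem breakCost_twelve {β : ℕ} (hβ : 5 ≤ β) :
    ∀ g, 0 < g → g ≤ Nat.factorial 25 → BreakCost β 12 g :=
  BreakCost.of_le_step (b := 5) (k := 32) (breakCost_eleven hβ) (by norm_num) (by omega)
    (Nat.factorial_le (by norm_num)) (by norm_num) (by norm_num [Nat.factorial])

theorem two_pow_le_factorial_two_pow (b : ℕ) (hb : 5 ≤ b) :
    2 ^ (2 * b * (b - 1)) ≤ (2 ^ (b - 1) - 1).factorial := by
  induction b, hb using Nat.le_induction with
  | base => norm_num [Nat.factorial]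
  | succ b hb ih =>
    obtain ⟨c, rfl⟩ : ∃ c, b = c + 1 := ⟨b - 1, by omega⟩
    simp only [Nat.add_sub_cancel] at ih ⊢
    have h0 := Nat.two_pow_pos c
    have h1 := Nat.factorial_mul_pow_le_factorial (m := 2 ^ c - 1) (n := 2 ^ c)
    rw [Nat.sub_add_cancel h0] at h1
    have h2 : 2 ^ c - 1 + 2 ^ c = 2 ^ (c + 1) - 1 := by rw [pow_succ]; omega
    rw [h2] at h1
    refine le_trans ?_ h1
    refine le_trans ?_ (Nat.mul_le_mul_right _ ih)
    rw [← pow_mul, ← pow_add]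
    refine Nat.pow_le_pow_right (by norm_num) ?_
    have h3 : 16 ≤ 2 ^ c := by
      calc 16 = 2 ^ 4 := by norm_num
        _ ≤ 2 ^ c := Nat.pow_le_pow_right (by norm_num) (by omega)
    nlinarith

theorem breakCost_of_le_factorial {β : ℕ} (hβ : 5 ≤ β) (s : ℕ) (hs : 12 ≤ s) :
    2 * s + 1 ≤ 2 ^ β → ∀ g, 0 < g → g ≤ (2 * s + 1).factorial → BreakCost β s g := by
  induction s, hs using Nat.le_induction with
  | base => exact fun _ => breakCost_twelve hβ
  | succ s hs ih =>
    intro hsβ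
    have hb2 : 2 * s + 3 ≤ 2 ^ Nat.clog 2 (2 * s + 3) := Nat.le_pow_clog (by norm_num) _
    have hb1 : 2 ^ (Nat.clog 2 (2 * s + 3) - 1) < 2 * s + 3 :=
      Nat.pow_pred_clog_lt_self (b := 2) (x := 2 * s + 3) (by norm_num) (by omega)
    have hbβ : Nat.clog 2 (2 * s + 3) ≤ β := Nat.clog_le_of_le_pow (by omega)
    set b := Nat.clog 2 (2 * s + 3)
    have hb5 : 5 ≤ b := by
      by_contra! h
      have : 2 ^ b ≤ 2 ^ 4 := Nat.pow_le_pow_right (by norm_num) (by omega)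
      omega
    refine BreakCost.of_le_step (b := b) (k := 2 * s + 3) (ih (by omega)) (by omega) hbβ
      (by rw [show 2 * (s + 1) + 1 = 2 * s + 3 by ring]) hb2 ?_
    have h1 : (2 * (s + 1) + 1).factorial =
        ((2 * s + 3) * (2 * s + 2)) * (2 * s + 1).factorial := by
      rw [show 2 * (s + 1) + 1 = (2 * s + 1) + 1 + 1 by ring, Nat.factorial_succ,
        Nat.factorial_succ]
      ring
    have h2 : ((2 * s + 3) * (2 * s + 2)) ^ (b - 1) ≤ (2 * s + 1).factorial := by
      calc _ ≤ (2 ^ b * 2 ^ b) ^ (b - 1) :=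
            Nat.pow_le_pow_left (Nat.mul_le_mul hb2 (by omega)) _
        _ = 2 ^ (2 * b * (b - 1)) := by rw [← pow_add, ← pow_mul]; ring_nf
        _ ≤ _ := two_pow_le_factorial_two_pow b hb5
        _ ≤ _ := Nat.factorial_le (by omega)
    rw [h1, mul_pow]
    calc _ ≤ (2 * s + 1).factorial * (2 * s + 1).factorial ^ (b - 1) :=
          Nat.mul_le_mul_right _ h2
      _ = (2 * s + 1).factorial ^ b := by
          rw [← pow_succ', Nat.sub_add_cancel (by omega)]
      _ < _ := Nat.pow_lt_pow_left (Nat.lt_succ_self _) (by omega)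

theorem breakCost_of_rule {β s g b k T C : ℕ} (hg : 0 < g) (hC : g < C * (T + 1))
    (hdvd : ∀ d, 0 < d → d ≤ g / 2 → BreakCost β (s + 1) d)
    (hT : ∀ d, 0 < d → d ≤ T → BreakCost β s d) (hb : b ≠ 0) (hbβ : b ≤ β)
    (hgk : g ≤ k.factorial) (hk : k ≤ 2 ^ b)
    (hc : ∀ c < C, c ∣ g → (g / c) ^ b ≤ g ^ (b - 1) → g / c ≤ T ∨
      BreakCost β s (g / c)) : BreakCost β (s + 1) g := by
  intro d hd
  by_cases hdg : d = g
  · subst hdg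
    refine Or.inr (Or.inr ⟨b, k, hb, hbβ, hgk, hk, ?_⟩)
    intro e he hle
    obtain ⟨c, hc'⟩ := he
    have he0 : 0 < e := Nat.pos_of_dvd_of_pos ⟨c, hc'⟩ hg
    by_cases heT : e ≤ T
    · exact hT e he0 heT
    have hc0 : 0 < c := Nat.pos_of_ne_zero (by rintro rfl; omega)
    have hde : d / c = e := by rw [hc']; exact Nat.mul_div_cancel _ hc0
    have := hc c (by
      by_contra! h
      have : C * (T + 1) ≤ e * c := by
        rw [mul_comm e]
        exact Nat.mul_le_mul h (by omega)
      omega) (Dvd.intro_left e hc'.symm) (hde ▸ hle)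
    rcases this with h | h
    · omega
    · exact hde ▸ h
  · refine hdvd d (Nat.pos_of_dvd_of_pos hd hg) ?_ d dvd_rfl
    obtain ⟨c, rfl⟩ := hd
    have : 2 ≤ c := by
      rcases c with _ | _ | c
      · simp at hg
      · simp at hdg
      · omega
    rw [Nat.le_div_iff_mul_le (by norm_num)]
    exact Nat.mul_le_mul_left _ this

theorem breakCost_three_135 {β : ℕ} (hβ : 5 ≤ β) : BreakCost β 3 135 :=
  breakCost_of_rule (b := 3) (k := 6) (T := 24) (C := 6) (by norm_num) (by norm_num)
    (fun d h0 hd => breakCost_three hβ d h0 (by omega)) (breakCost_two hβ) (by norm_num) (by omega)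
    (by decide) (by norm_num) (fun c hc hd hp => by
      left
      interval_cases c <;> revert hp hd <;> decide)

theorem breakCost_three_144 {β : ℕ} (hβ : 5 ≤ β) : BreakCost β 3 144 :=
  breakCost_of_rule (b := 3) (k := 6) (T := 24) (C := 6) (by norm_num) (by norm_num)
    (fun d h0 hd => breakCost_three hβ d h0 (by omega)) (breakCost_two hβ) (by norm_num) (by omega)
    (by decide) (by norm_num) (fun c hc hd hp => by
      left
      interval_cases c <;> revert hp hd <;> decide)

theorem breakCost_four_2160 {β : ℕ} (hβ : 5 ≤ β) : BreakCost β 4 2160 :=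
  breakCost_of_rule (b := 3) (k := 7) (T := 124) (C := 18) (by norm_num) (by norm_num)
    (fun d h0 hd => breakCost_four hβ d h0 (by omega)) (breakCost_three hβ) (by norm_num) (by omega)
    (by decide) (by norm_num) (fun c hc hd hp => by
      have : 2160 / c ≤ 124 ∨ 2160 / c = 135 ∨ 2160 / c = 144 := by
        clear hβ
        interval_cases c <;> revert hp hd <;> decide
      rcases this with h | h | h
      · exact Or.inl h
      · exact Or.inr (h ▸ breakCost_three_135 hβ)
      · exact Or.inr (h ▸ breakCost_three_144 hβ))

/-- Twice the weight of a prime `p`. -/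
def wt (p : ℕ) : ℕ :=
  if p = 5 then 8 else if p = 7 then 10 else if p = 11 then 16 else if p = 13 then 16 else
  if p = 17 then 18 else p

theorem le_wt (p : ℕ) : p ≤ wt p := by
  unfold wt
  split_ifs <;> omega

theorem dvd_factorial_of_wt {g n : ℕ} (hg : g ≠ 0)
    (h : ∀ p, p.Prime → wt p * g.factorization p ≤ n) : g ∣ n.factorial := by
  rw [← Nat.factorization_le_iff_dvd hg (Nat.factorial_ne_zero n)]
  intro p
  by_cases hp : p.Prime
  · have h1 : p * g.factorization p ≤ n := (Nat.mul_le_mul_right _ (le_wt p)).trans (h p hp)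
    have h2 : p ^ g.factorization p ∣ n.factorial := by
      have h3 : (p * g.factorization p).factorial ∣ n.factorial := Nat.factorial_dvd_factorial h1
      refine Dvd.dvd.trans ?_ h3
      generalize g.factorization p = k
      induction k with
      | zero => simp
      | succ k ih =>
        have h4 : (p * k).factorial * p ∣ (p * (k + 1)).factorial := by
          have h5 : (p * k).factorial * p.factorial ∣ (p * k + p).factorial :=
            Nat.factorial_mul_factorial_dvd_factorial_add _ _
          rw [mul_add, mul_one]
          exact (Nat.mul_dvd_mul_left _ (Nat.dvd_factorial hp.pos le_rfl)).trans h5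
        rw [pow_succ]
        exact (Nat.mul_dvd_mul_right ih p).trans h4
    exact (hp.pow_dvd_iff_le_factorization (Nat.factorial_ne_zero n)).1 h2
  · rw [Nat.factorization_eq_zero_of_not_prime _ hp]
    exact Nat.zero_le _

theorem dvd_prod_of_wt {g n : ℕ} (hg : g ≠ 0) (hn : n ≤ 25)
    (h : ∀ p, p.Prime → wt p * g.factorization p ≤ n) :
    g ∣ 2 ^ (n / 2) * 3 ^ (n / 3) * 5 ^ (n / 8) * 7 ^ (n / 10) * 11 ^ (n / 16) * 13 ^ (n / 16) *
      17 ^ (n / 18) * 19 ^ (n / 19) * 23 ^ (n / 23) := by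
  have hsub : g.primeFactors ⊆ {2, 3, 5, 7, 11, 13, 17, 19, 23} := by
    intro p hp
    have hpp := Nat.prime_of_mem_primeFactors hp
    have h1 : 0 < g.factorization p :=
      hpp.factorization_pos_of_dvd hg (Nat.dvd_of_mem_primeFactors hp)
    have h2 := h p hpp
    have h3 := le_wt p
    have h4 : p ≤ 25 := by nlinarith
    clear h2 h3 h1 hp
    interval_cases p <;> revert hpp <;> decide
  have hprod : g ∣ ∏ p ∈ ({2, 3, 5, 7, 11, 13, 17, 19, 23} : Finset ℕ), p ^ (n / wt p) := by
    conv_lhs => rw [← Nat.prod_factorization_pow_eq_self hg]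
    refine (Finset.prod_dvd_prod_of_subset _ _ _ hsub).trans ?_
    refine Finset.prod_dvd_prod_of_dvd _ _ fun p hp => ?_
    refine pow_dvd_pow _ ?_
    have hpp : p.Prime := by
      revert p
      decide
    rw [Nat.le_div_iff_mul_le (hpp.pos.trans_le (le_wt p)), mul_comm]
    exact h p hpp
  convert hprod using 1
  simp [Finset.prod_insert, wt]
  ring

/-- The cost of a group order `g ≠ 1, 6` is bounded by the weight of some prime in `g`. -/
theorem exists_cost {β g M : ℕ} (hβ : 5 ≤ β) (hg : 1 < g) (h6 : g ≠ 6)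
    (hM : ∀ p, p.Prime → wt p * g.factorization p ≤ M) (hMβ : M < 2 ^ β) :
    ∃ s p, p.Prime ∧ BreakCost β s g ∧ 2 * s ≤ wt p * g.factorization p := by
  have hg0 : 0 < g := by omega
  obtain ⟨p, hp, hmax⟩ := Finset.exists_max_image g.primeFactors
    (fun p => wt p * g.factorization p) (Nat.nonempty_primeFactors.2 hg)
  have hpp := Nat.prime_of_mem_primeFactors hp
  have hmax' : ∀ q, q.Prime → wt q * g.factorization q ≤ wt p * g.factorization p := by
    intro q hq
    by_cases hqg : q ∈ g.primeFactors
    · exact hmax q hqg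
    · rw [Finsupp.notMem_support_iff.1 (by rwa [Nat.support_factorization])]
      simp
  have hMp := hM p hpp
  refine ⟨(wt p * g.factorization p) / 2, p, hpp, ?_, Nat.mul_div_le _ _⟩
  generalize wt p * g.factorization p = μ at *
  have h1 : ∀ q, q.Prime → wt q * g.factorization q ≤ 2 * (μ / 2) + 1 := fun q hq =>
    (hmax' q hq).trans (by omega)
  have hs : 2 * (μ / 2) ≤ M := (Nat.mul_div_le _ _).trans hMp
  generalize μ / 2 = s at *
  by_cases h12 : 12 ≤ s
  · exact breakCost_of_le_factorial hβ s h12 (by omega) g hg0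
      (Nat.le_of_dvd (Nat.factorial_pos _) (dvd_factorial_of_wt hg0.ne' h1))
  · have hd := dvd_prod_of_wt hg0.ne' (by omega) h1
    clear h1 hmax' hmax hM
    push Not at h12
    have key : ∀ N T, g ∣ N → 0 < N → N ≤ T → g ≤ T := fun N T h1 h2 h3 =>
      (Nat.le_of_dvd h2 h1).trans h3
    interval_cases s <;> norm_num at hd
    · omega
    · have : g ≤ 6 := Nat.le_of_dvd (by norm_num) hd
      exact breakCost_one g hg0 (by omega)
    · exact breakCost_two hβ g hg0 (key _ _ hd (by norm_num) (by norm_num))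
    · exact breakCost_three hβ g hg0 (key _ _ hd (by norm_num) (by norm_num))
    · exact (breakCost_four_2160 hβ).of_dvd hd
    · exact breakCost_five hβ g hg0 (key _ _ hd (by norm_num) (by norm_num))
    · exact breakCost_six hβ g hg0 (key _ _ hd (by norm_num) (by norm_num))
    · exact breakCost_seven hβ g hg0 (key _ _ hd (by norm_num) (by norm_num))
    · exact breakCost_eight hβ g hg0 (key _ _ hd (by norm_num) (by norm_num))
    · exact breakCost_nine hβ g hg0 (key _ _ hd (by norm_num) (by norm_num))
    · exact breakCost_ten hβ g hg0 (key _ _ hd (by norm_num) (by norm_num))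
    · exact breakCost_eleven hβ g hg0 (key _ _ hd (by norm_num) (by norm_num))

theorem five_mul_wt_le (p : ℕ) : 5 * wt p ≤ 8 * p := by
  unfold wt
  split_ifs <;> omega

/-- The total weight of the prime factors of `n`, with multiplicity. -/
def totalWt (n : ℕ) : ℕ := (n.primeFactorsList.map wt).sum

theorem totalWt_one : totalWt 1 = 0 := by simp [totalWt]

theorem totalWt_mul {a b : ℕ} (ha : a ≠ 0) (hb : b ≠ 0) :
    totalWt (a * b) = totalWt a + totalWt b := by
  unfold totalWt
  rw [((Nat.perm_primeFactorsList_mul ha hb).map wt).sum_eq, List.map_append, List.sum_append]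

theorem totalWt_prime {p : ℕ} (hp : p.Prime) : totalWt p = wt p := by
  simp [totalWt, Nat.primeFactorsList_prime hp]

theorem totalWt_pow {p : ℕ} (hp : p.Prime) (k : ℕ) : totalWt (p ^ k) = wt p * k := by
  induction k with
  | zero => simp [totalWt_one]
  | succ k ih => rw [pow_succ, totalWt_mul (pow_ne_zero _ hp.ne_zero) hp.ne_zero, ih,
      totalWt_prime hp]; ring

theorem totalWt_le_of_dvd {a b : ℕ} (h : a ∣ b) (hb : b ≠ 0) : totalWt a ≤ totalWt b := by
  obtain ⟨c, rfl⟩ := h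
  rw [totalWt_mul (left_ne_zero_of_mul hb) (right_ne_zero_of_mul hb)]
  exact Nat.le_add_right _ _

theorem wt_mul_factorization_le {n p : ℕ} (hp : p.Prime) (hn : n ≠ 0) :
    wt p * n.factorization p ≤ totalWt n := by
  rw [← totalWt_pow hp]
  exact totalWt_le_of_dvd (Nat.ordProj_dvd n p) hn

theorem five_mul_totalWt_le (n : ℕ) (hn : n ≠ 0) : 5 * totalWt n ≤ 8 * n := by
  induction n using Nat.recOnMul with
  | zero => exact absurd rfl hn
  | one => simp [totalWt_one]
  | prime p hp => rw [totalWt_prime hp]; exact five_mul_wt_le p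
  | mul a b iha ihb =>
    have ha := left_ne_zero_of_mul hn
    have hb := right_ne_zero_of_mul hn
    by_cases ha1 : a = 1
    · subst ha1; simpa using ihb hb
    by_cases hb1 : b = 1
    · subst hb1; simpa using iha ha
    rw [totalWt_mul ha hb]
    have h1 := iha ha
    have h2 := ihb hb
    have : a + b ≤ a * b := by
      have : 2 ≤ a := by omega
      have : 2 ≤ b := by omega
      nlinarith
    omega

theorem five_mul_totalWt_le_six (n : ℕ) (hn : 14 ≤ n) : 5 * totalWt n ≤ 6 * n := by
  induction n using Nat.strong_induction_on with
  | _ n ih =>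
  have hp := Nat.minFac_prime (n := n) (by omega)
  obtain ⟨y, hy⟩ := Nat.minFac_dvd n
  set p := n.minFac
  have hy0 : y ≠ 0 := by rintro rfl; omega
  have h2 := hp.two_le
  rw [hy, totalWt_mul hp.ne_zero hy0, totalWt_prime hp]
  have h8 := five_mul_wt_le p
  by_cases hy1 : y = 1
  · subst hy1
    have hnp : 14 ≤ p := by omega
    rw [totalWt_one]
    unfold wt
    split_ifs <;> omega
  by_cases hy14 : 14 ≤ y
  · have := ih y (by rw [hy]; nlinarith) hy14
    nlinarith
  · have hy8 := five_mul_totalWt_le y hy0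
    have hy2 : 2 ≤ y := by omega
    by_cases hp4 : 4 ≤ p
    · nlinarith
    · have hcase : p = 2 ∨ p = 3 := by omega
      rcases hcase with h | h
      · rw [h] at hy ⊢
        have : wt 2 = 2 := rfl
        omega
      · rw [h] at hy ⊢
        have : wt 3 = 3 := rfl
        omega

/-- Twice the bound on the total weight of a normal chain in a permutation group of
degree `m`. -/
def chainBound (m : ℕ) : ℕ := if m = 7 then 15 else 3 * (m - 1)

theorem chainBound_le (m : ℕ) : chainBound m ≤ 3 * (m - 1) := by
  unfold chainBound
  split_ifs <;> omega

theorem le_chainBound (m : ℕ) : 3 * m - 6 ≤ chainBound m := by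
  unfold chainBound
  split_ifs <;> omega

/-- The order of the general linear group of degree `a` over the field with `p` elements. -/
def cardGL (p a : ℕ) : ℕ := ∏ i ∈ Finset.range a, (p ^ a - p ^ i)

theorem cardGL_succ (p a : ℕ) :
    cardGL p (a + 1) = (p ^ (a + 1) - 1) * (p ^ a * cardGL p a) := by
  unfold cardGL
  rw [Finset.prod_range_succ', mul_comm, pow_zero]
  congr 1
  have : ∀ i ∈ Finset.range a, p ^ (a + 1) - p ^ (i + 1) = p * (p ^ a - p ^ i) := by
    intro i _
    rw [Nat.mul_sub, pow_succ', pow_succ']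
  rw [Finset.prod_congr rfl this, Finset.prod_mul_distrib, Finset.prod_const, Finset.card_range]

theorem cardGL_ne_zero {p : ℕ} (hp : 2 ≤ p) (a : ℕ) : cardGL p a ≠ 0 := by
  unfold cardGL
  rw [Finset.prod_ne_zero_iff]
  intro i hi
  have := Nat.pow_lt_pow_right (a := p) (by omega) (Finset.mem_range.1 hi)
  omega

/-- Total weight of the affine general linear group. -/
def affWt (p a : ℕ) : ℕ := wt p * a + totalWt (cardGL p a)

theorem affWt_succ {p : ℕ} (hp : p.Prime) (a : ℕ) :
    affWt p (a + 1) = affWt p a + wt p * (a + 1) + totalWt (p ^ (a + 1) - 1) := by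
  have h1 : p ^ (a + 1) - 1 ≠ 0 := by
    have : 1 < p ^ (a + 1) := Nat.one_lt_pow (Nat.succ_ne_zero a) hp.one_lt
    omega
  have h2 : p ^ a ≠ 0 := pow_ne_zero _ hp.ne_zero
  have h3 := cardGL_ne_zero hp.two_le a
  unfold affWt
  rw [cardGL_succ, totalWt_mul h1 (mul_ne_zero h2 h3), totalWt_mul h2 h3, totalWt_pow hp]
  ring

theorem affWt_zero (p : ℕ) : affWt p 0 = 0 := by
  simp [affWt, cardGL, totalWt_one]

theorem totalWt_small : totalWt 2 = 2 ∧ totalWt 3 = 3 ∧ totalWt 4 = 4 ∧ totalWt 6 = 5 ∧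
    totalWt 7 = 10 ∧ totalWt 8 = 6 ∧ totalWt 10 = 10 ∧ totalWt 12 = 7 ∧ totalWt 15 = 11 ∧
    totalWt 16 = 8 ∧ totalWt 31 = 31 := by
  have h2 : totalWt 2 = 2 := totalWt_prime Nat.prime_two
  have h3 : totalWt 3 = 3 := totalWt_prime Nat.prime_three
  have h5 : totalWt 5 = 8 := totalWt_prime Nat.prime_five
  have h7 : totalWt 7 = 10 := totalWt_prime (by norm_num)
  have h31 : totalWt 31 = 31 := totalWt_prime (by norm_num)
  have h4 : totalWt 4 = 4 := by
    rw [show 4 = 2 * 2 by norm_num, totalWt_mul (by norm_num) (by norm_num), h2]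
  have h6 : totalWt 6 = 5 := by
    rw [show 6 = 2 * 3 by norm_num, totalWt_mul (by norm_num) (by norm_num), h2, h3]
  have h8 : totalWt 8 = 6 := by
    rw [show 8 = 2 * 4 by norm_num, totalWt_mul (by norm_num) (by norm_num), h2, h4]
  have h10 : totalWt 10 = 10 := by
    rw [show 10 = 2 * 5 by norm_num, totalWt_mul (by norm_num) (by norm_num), h2, h5]
  have h12 : totalWt 12 = 7 := by
    rw [show 12 = 2 * 6 by norm_num, totalWt_mul (by norm_num) (by norm_num), h2, h6]
  have h15 : totalWt 15 = 11 := by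
    rw [show 15 = 3 * 5 by norm_num, totalWt_mul (by norm_num) (by norm_num), h3, h5]
  have h16 : totalWt 16 = 8 := by
    rw [show 16 = 2 * 8 by norm_num, totalWt_mul (by norm_num) (by norm_num), h2, h8]
  exact ⟨h2, h3, h4, h6, h7, h8, h10, h12, h15, h16, h31⟩

theorem affWt_two (a : ℕ) (ha : a ≠ 3) (ha0 : a ≠ 0) : affWt 2 a + 3 ≤ 3 * 2 ^ a := by
  obtain ⟨h2, h3, h4, h6, h7, h8, h10, h12, h15, h16, h31⟩ := totalWt_small
  have hw : wt 2 = 2 := rfl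
  have e1 : affWt 2 1 = 2 := by
    rw [affWt_succ Nat.prime_two, affWt_zero, hw]; norm_num [totalWt_one]
  have e2 : affWt 2 2 = 9 := by
    rw [affWt_succ Nat.prime_two, e1, hw]; norm_num [h3]
  have e3 : affWt 2 3 = 25 := by
    rw [affWt_succ Nat.prime_two, e2, hw]; norm_num [h7]
  have e4 : affWt 2 4 = 44 := by
    rw [affWt_succ Nat.prime_two, e3, hw]; norm_num [h15]
  have e5 : affWt 2 5 = 85 := by
    rw [affWt_succ Nat.prime_two, e4, hw]; norm_num [h31]
  by_cases h5 : 5 ≤ a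
  · clear ha ha0
    induction a, h5 using Nat.le_induction with
    | base => rw [e5]; norm_num
    | succ a ha ih =>
      rw [affWt_succ Nat.prime_two, hw]
      have h32 : 32 ≤ 2 ^ a := by
        calc 32 = 2 ^ 5 := by norm_num
          _ ≤ _ := Nat.pow_le_pow_right (by norm_num) ha
      have h1 := five_mul_totalWt_le_six (2 ^ (a + 1) - 1) (by rw [pow_succ]; omega)
      have h2 : 10 * (a + 1) ≤ 3 * 2 ^ a := by
        clear ih h1 h32
        induction a, ha using Nat.le_induction with
        | base => norm_num
        | succ a ha ih => rw [pow_succ]; omega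
      rw [pow_succ] at *
      omega
  · have : a = 1 ∨ a = 2 ∨ a = 4 := by omega
    rcases this with rfl | rfl | rfl <;> simp [e1, e2, e4]

theorem affWt_three (a : ℕ) (ha0 : a ≠ 0) : affWt 3 a + 3 ≤ 3 * 3 ^ a := by
  obtain ⟨h2, h3, h4, h6, h7, h8, h10, h12, h15, h16, h31⟩ := totalWt_small
  have hw : wt 3 = 3 := rfl
  have e1 : affWt 3 1 = 5 := by
    rw [affWt_succ Nat.prime_three, affWt_zero, hw]; norm_num [h2]
  have e2 : affWt 3 2 = 17 := by
    rw [affWt_succ Nat.prime_three, e1, hw]; norm_num [h8]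
  by_cases h5 : 2 ≤ a
  · clear ha0
    induction a, h5 using Nat.le_induction with
    | base => rw [e2]; norm_num
    | succ a ha ih =>
      rw [affWt_succ Nat.prime_three, hw]
      have h32 : 9 ≤ 3 ^ a := by
        calc 9 = 3 ^ 2 := by norm_num
          _ ≤ _ := Nat.pow_le_pow_right (by norm_num) ha
      have h1 := five_mul_totalWt_le (3 ^ (a + 1) - 1) (by rw [pow_succ]; omega)
      have h2 : 5 * (a + 1) ≤ 2 * 3 ^ a := by
        clear ih h1 h32
        induction a, ha using Nat.le_induction with
        | base => norm_num
        | succ a ha ih => rw [pow_succ]; omega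
      rw [pow_succ] at *
      omega
  · have : a = 1 := by omega
    rw [this, e1]; norm_num

theorem affWt_of_five_le {p : ℕ} (hp : p.Prime) (hp5 : 5 ≤ p) (a : ℕ) (ha0 : a ≠ 0) :
    affWt p a ≤ chainBound (p ^ a) := by
  obtain ⟨h2, h3, h4, h6, h7, h8, h10, h12, h15, h16, h31⟩ := totalWt_small
  have hbase : affWt p 1 ≤ chainBound p := by
    rw [affWt_succ hp, affWt_zero, zero_add, zero_add, pow_one, mul_one]
    by_cases h19 : 19 ≤ p
    · have h1 := five_mul_totalWt_le (p - 1) (by omega)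
      unfold chainBound wt
      split_ifs <;> omega
    · push Not at h19
      have : p = 5 ∨ p = 7 ∨ p = 11 ∨ p = 13 ∨ p = 17 := by
        clear h2 h3 h4 h6 h7 h8 h10 h12 h15 h16 h31
        interval_cases p <;> first | omega | (exfalso; revert hp; norm_num)
      rcases this with rfl | rfl | rfl | rfl | rfl <;>
        norm_num [wt, chainBound, h4, h6, h10, h12, h16]
  induction a, Nat.one_le_iff_ne_zero.2 ha0 using Nat.le_induction with
  | base => simpa using hbase
  | succ a ha ih =>
    have hpa : 5 ≤ p ^ a := hp5.trans (Nat.le_self_pow (by omega) p)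
    have hne : p ^ (a + 1) ≠ 7 := by
      intro h
      have : 25 ≤ p ^ (a + 1) := by
        rw [pow_succ]
        nlinarith
      omega
    have h1 := five_mul_totalWt_le (p ^ (a + 1) - 1) (by
      rw [pow_succ]
      have := Nat.mul_le_mul hpa hp5
      omega)
    have h2 := (ih (by omega)).trans (chainBound_le _)
    have h3 := five_mul_wt_le p
    have h4 : 8 * (a + 1) + 15 * p ^ (a - 1) ≤ 7 * p ^ a := by
      clear ih h1 h2 hne hpa ha0
      induction a, ha using Nat.le_induction with
      | base => norm_num; omega
      | succ a ha ih =>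
        obtain ⟨b, rfl⟩ : ∃ b, a = b + 1 := ⟨a - 1, by omega⟩
        simp only [Nat.add_sub_cancel] at ih ⊢
        rw [pow_succ p (b + 1)]
        have : p ^ (b + 1) = p ^ b * p := pow_succ _ _
        nlinarith
    rw [affWt_succ hp]
    unfold chainBound
    rw [if_neg hne]
    obtain ⟨b, rfl⟩ : ∃ b, a = b + 1 := ⟨a - 1, by omega⟩
    simp only [Nat.add_sub_cancel] at h4
    have e1 : p ^ (b + 1) = p ^ b * p := pow_succ _ _
    have e2 : p ^ (b + 1 + 1) = p ^ (b + 1) * p := pow_succ _ _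
    have h5 : 5 * (wt p * (b + 1 + 1)) ≤ 8 * (p * (b + 1 + 1)) := by nlinarith
    have h6 : p * (8 * (b + 1 + 1) + 15 * p ^ b) ≤ p * (7 * p ^ (b + 1)) := Nat.mul_le_mul_left _ h4
    have h7 : 8 * (p * (b + 1 + 1)) + 15 * p ^ (b + 1) ≤ 7 * p ^ (b + 1 + 1) := by
      rw [e2]; nlinarith
    omega

theorem affWt_le_chainBound {p : ℕ} (hp : p.Prime) (a : ℕ) (ha0 : a ≠ 0) (h8 : p ^ a ≠ 8) :
    affWt p a ≤ chainBound (p ^ a) := by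
  by_cases h5 : 5 ≤ p
  · exact affWt_of_five_le hp h5 a ha0
  · have h2 := hp.two_le
    have hne : p ^ a ≠ 7 := by
      intro h
      have : p ∣ 7 := h ▸ dvd_pow_self p ha0
      push Not at h5
      interval_cases p <;> revert this <;> decide
    unfold chainBound
    rw [if_neg hne]
    have : p = 2 ∨ p = 3 := by
      push Not at h5
      interval_cases p
      · simp
      · simp
      · exact absurd hp (by norm_num)
    rcases this with rfl | rfl
    · have := affWt_two a (by rintro rfl; simp at h8) ha0
      omega
    · have := affWt_three a ha0
      omega

/-- Along every normal chain of `A` and for every choice of a prime at each step, the weighted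
number of occurrences of the chosen primes in the indices is at most `c`. -/
def ChainWeightLE (A : Type*) [Group A] (c : ℕ) : Prop :=
  ∀ (L : ℕ → Subgroup A) (p : ℕ → ℕ) (r : ℕ), Monotone L → (∀ i, (L i).Normal) →
    (∀ i, (p i).Prime) →
    ∑ i ∈ Finset.range r, wt (p i) * ((L i).relIndex (L (i + 1))).factorization (p i) ≤ c

theorem ChainWeightLE.mono {A : Type*} [Group A] {c d : ℕ} (h : ChainWeightLE A c) (hcd : c ≤ d) :
    ChainWeightLE A d :=
  fun L p r hm hn hp => (h L p r hm hn hp).trans hcd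

theorem card_mul_relIndex_eq {A : Type*} [Group A] {K M : Subgroup A} (h : K ≤ M) :
    Nat.card K * K.relIndex M = Nat.card M := by
  have := Subgroup.relIndex_mul_relIndex (⊥ : Subgroup A) K M bot_le h
  simpa [Subgroup.relIndex_bot_left] using this

theorem prod_relIndex_mul_card {A : Type*} [Group A] (L : ℕ → Subgroup A) (hm : Monotone L)
    (r : ℕ) :
    Nat.card (L 0) * ∏ i ∈ Finset.range r, (L i).relIndex (L (i + 1)) = Nat.card (L r) := by
  induction r with
  | zero => simp
  | succ r ih =>
    rw [Finset.prod_range_succ, ← mul_assoc, ih, card_mul_relIndex_eq (hm (Nat.le_succ r))]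

theorem totalWt_prod {ι : Type*} (s : Finset ι) (f : ι → ℕ) (hf : ∀ i ∈ s, f i ≠ 0) :
    totalWt (∏ i ∈ s, f i) = ∑ i ∈ s, totalWt (f i) := by
  classical
  induction s using Finset.induction_on with
  | empty => simp [totalWt_one]
  | insert i s hi ih =>
    rw [Finset.prod_insert hi, Finset.sum_insert hi,
      totalWt_mul (hf i (by simp)) (Finset.prod_ne_zero_iff.2 fun j hj => hf j (by simp [hj])),
      ih fun j hj => hf j (by simp [hj])]

theorem chainWeightLE_totalWt (A : Type*) [Group A] [Finite A] :
    ChainWeightLE A (totalWt (Nat.card A)) := by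
  intro L p r hm _ hp
  have hne : ∀ i ∈ Finset.range r, (L i).relIndex (L (i + 1)) ≠ 0 :=
    fun i _ => Subgroup.FiniteIndex.index_ne_zero
  calc _ ≤ ∑ i ∈ Finset.range r, totalWt ((L i).relIndex (L (i + 1))) :=
        Finset.sum_le_sum fun i hi => wt_mul_factorization_le (hp i) (hne i hi)
    _ = totalWt (∏ i ∈ Finset.range r, (L i).relIndex (L (i + 1))) := (totalWt_prod _ _ hne).symm
    _ ≤ _ := by
        refine totalWt_le_of_dvd ?_ Nat.card_pos.ne'
        exact (Dvd.intro_left _ (prod_relIndex_mul_card L hm r)).trans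
          (Subgroup.card_subgroup_dvd_card _)

theorem card_eq_card_map_mul {A B : Type*} [Group A] [Group B] [Finite A] (f : A →* B)
    (K : Subgroup A) :
    Nat.card K = Nat.card (K.map f) * Nat.card (K.subgroupOf f.ker) := by
  rw [← Subgroup.relIndex_ker K f, mul_comm, ← Subgroup.relIndex_bot_left K,
    ← Subgroup.relIndex_bot_left (K.subgroupOf f.ker),
    ← Subgroup.relIndex_mul_relIndex ⊥ (f.ker ⊓ K) K bot_le inf_le_right,
    Subgroup.inf_relIndex_right, Subgroup.relIndex_bot_left, Subgroup.relIndex_bot_left,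
    ← Subgroup.inf_subgroupOf_left,
    Nat.card_congr (Subgroup.subgroupOfEquivOfLe inf_le_left).toEquiv]

theorem ChainWeightLE.of_hom {A B : Type*} [Group A] [Group B] [Finite A] (f : A →* B)
    {c₁ c₂ : ℕ} (h₁ : ChainWeightLE f.range c₁) (h₂ : ChainWeightLE f.ker c₂) :
    ChainWeightLE A (c₁ + c₂) := by
  intro L p r hm hn hp
  have hcard : ∀ K M : Subgroup A, K ≤ M → K.relIndex M =
      (K.map f.rangeRestrict).relIndex (M.map f.rangeRestrict) *
        (K.subgroupOf f.ker).relIndex (M.subgroupOf f.ker) := by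
    intro K M hKM
    have e1 := card_mul_relIndex_eq hKM
    have e2 := card_mul_relIndex_eq (Subgroup.map_mono (f := f.rangeRestrict) hKM)
    have e3 := card_mul_relIndex_eq (Subgroup.comap_mono (f := f.ker.subtype) hKM)
    have e4 := card_eq_card_map_mul f.rangeRestrict K
    have e5 := card_eq_card_map_mul f.rangeRestrict M
    rw [MonoidHom.ker_rangeRestrict] at e4 e5
    have hpos : 0 < Nat.card K := Nat.card_pos
    apply Nat.eq_of_mul_eq_mul_left hpos
    rw [e1, e5, ← e2, e4, Subgroup.subgroupOf, Subgroup.subgroupOf, ← e3]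
    ring
  have g1 := h₁ (fun i => (L i).map f.rangeRestrict) p r
    (fun i j hij => Subgroup.map_mono (hm hij))
    (fun i => (hn i).map _ f.rangeRestrict_surjective) hp
  have g2 := h₂ (fun i => (L i).subgroupOf f.ker) p r
    (fun i j hij => Subgroup.comap_mono (hm hij))
    (fun i => (hn i).comap _) hp
  refine le_trans (le_of_eq ?_) (add_le_add g1 g2)
  rw [← Finset.sum_add_distrib]
  refine Finset.sum_congr rfl fun i _ => ?_
  rw [hcard _ _ (hm (Nat.le_succ i)), Nat.factorization_mul, Finsupp.add_apply, mul_add]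
  · have : Finite f.range := Finite.of_surjective _ f.rangeRestrict_surjective
    exact Subgroup.index_ne_zero_of_finite
  · exact Subgroup.index_ne_zero_of_finite

theorem ChainWeightLE.of_subsingleton (A : Type*) [Group A] [Subsingleton A] :
    ChainWeightLE A 0 := by
  intro L p r hm hn hp
  simp [Subsingleton.elim _ (⊤ : Subgroup A)]

theorem ChainWeightLE.of_family.{u, v} {ι : Type*} {B : ι → Type v} [∀ i, Group (B i)] {c : ι → ℕ}
    (s : Finset ι) (hB : ∀ i ∈ s, ∀ C : Subgroup (B i), ChainWeightLE C (c i)) :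
    ∀ (A : Type u) [Group A] [Finite A] (f : ∀ i, A →* B i),
      (∀ a, (∀ i ∈ s, f i a = 1) → a = 1) → ChainWeightLE A (∑ i ∈ s, c i) := by
  classical
  induction s using Finset.induction_on with
  | empty =>
    intro A _ _ f hf
    have : Subsingleton A := ⟨fun a b => by rw [hf a (by simp), hf b (by simp)]⟩
    simpa using ChainWeightLE.of_subsingleton A
  | insert i s hi ih =>
    intro A _ _ f hf
    rw [Finset.sum_insert hi]
    refine ChainWeightLE.of_hom (f i) (hB i (by simp) _) ?_
    refine ih (fun j hj => hB j (by simp [hj])) _ (fun j => (f j).comp (f i).ker.subtype) ?_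
    intro a ha
    apply Subtype.ext
    refine hf a fun j hj => ?_
    rcases Finset.mem_insert.1 hj with rfl | hj
    · exact a.2
    · exact ha j hj

theorem ChainWeightLE.of_injective {A B : Type*} [Group A] [Group B] [Finite A] (f : A →* B)
    (hf : Function.Injective f) {c : ℕ} (h : ∀ C : Subgroup B, ChainWeightLE C c) :
    ChainWeightLE A c := by
  have hk : Subsingleton f.ker := by
    rw [(MonoidHom.ker_eq_bot_iff f).2 hf]; infer_instance
  simpa using ChainWeightLE.of_hom f (h _) (ChainWeightLE.of_subsingleton f.ker)

theorem relIndex_subgroupOf_of_sup_eq_top {A : Type*} [Group A] {K M Y : Subgroup A} [K.Normal]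
    (hKY : K ⊔ Y = ⊤) (hKM : K ≤ M) :
    (K.subgroupOf Y).relIndex (M.subgroupOf Y) = K.relIndex M := by
  have h2 : K ⊔ (Y ⊓ M) = M := by
    refine le_antisymm (sup_le hKM inf_le_right) fun x hx => ?_
    have hx' : x ∈ K ⊔ Y := hKY ▸ Subgroup.mem_top x
    obtain ⟨k, hk, y, hy, rfl⟩ := Subgroup.mem_sup_of_normal_left.1 hx'
    exact Subgroup.mul_mem_sup hk ⟨hy, (Subgroup.mul_mem_cancel_left _ (hKM hk)).1 hx⟩
  conv_rhs => rw [← h2, Subgroup.relIndex_sup_left]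
  rw [← Subgroup.inf_subgroupOf_left M Y, Subgroup.relIndex_subgroupOf inf_le_left]

/-- Every finite group acting faithfully on `m` points has chain weight at most `chainBound m`. -/
def ActionBound.{u} (m : ℕ) : Prop :=
  ∀ (A Ω : Type u) [Group A] [Finite A] [MulAction A Ω] [FaithfulSMul A Ω] [Finite Ω],
    Nat.card Ω = m → ChainWeightLE A (chainBound m)

section

universe u

theorem ActionBound.perm {Ω : Type u} [Finite Ω] (h : ActionBound.{u} (Nat.card Ω))
    (C : Subgroup (Equiv.Perm Ω)) : ChainWeightLE C (chainBound (Nat.card Ω)) :=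
  h C Ω rfl

theorem ChainWeightLE.of_invariant_partition {A Ω : Type u} [Group A] [Finite A] [MulAction A Ω]
    [FaithfulSMul A Ω] [Finite Ω] {ι : Type*} [Fintype ι] (q : Ω → ι)
    (hq : ∀ (a : A) x, q (a • x) = q x)
    (h : ∀ i, ActionBound.{u} (Nat.card {x // q x = i})) :
    ChainWeightLE A (∑ i, chainBound (Nat.card {x // q x = i})) := by
  refine ChainWeightLE.of_family (B := fun i => Equiv.Perm {x // q x = i}) Finset.univ
    (fun i _ C => (h i).perm C) A
    (fun i => restrHom (fun x => q x = i) fun a x => by rw [hq a x]) ?_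
  intro a ha
  refine FaithfulSMul.eq_of_smul_eq_smul (α := Ω) fun x => ?_
  have := congrArg (fun e : Equiv.Perm {y // q y = q x} => ((e ⟨x, rfl⟩ : {y // q y = q x}) : Ω))
    (ha (q x) (Finset.mem_univ _))
  simpa [restrHom_apply_coe] using this

theorem sum_card_fiber {Ω ι : Type*} [Finite Ω] [Fintype ι] (q : Ω → ι) :
    ∑ i, Nat.card {x // q x = i} = Nat.card Ω := by
  rw [← Nat.card_sigma, Nat.card_congr (Equiv.sigmaFiberEquiv q)]

theorem card_fiber_lt {Ω ι : Type*} [Finite Ω] (q : Ω → ι) {x y : Ω} (h : q x ≠ q y)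
    (i : ι) : Nat.card {x // q x = i} < Nat.card Ω := by
  classical
  apply Finite.card_subtype_lt (p := fun x => q x = i) (x := if q x = i then y else x)
  split_ifs with h'
  · exact fun h'' => h (h'.trans h''.symm)
  · exact h'

theorem ChainWeightLE.of_not_isPretransitive {A Ω : Type u} [Group A] [Finite A] [MulAction A Ω]
    [FaithfulSMul A Ω] [Finite Ω] (h : ∀ m < Nat.card Ω, ActionBound.{u} m)
    (hA : ¬ MulAction.IsPretransitive A Ω) : ChainWeightLE A (chainBound (Nat.card Ω)) := by
  classical
  let q : Ω → MulAction.orbitRel.Quotient A Ω := Quotient.mk''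
  have hqs : Function.Surjective q := Quotient.mk''_surjective
  have : Finite (MulAction.orbitRel.Quotient A Ω) := Finite.of_surjective q hqs
  have := Fintype.ofFinite (MulAction.orbitRel.Quotient A Ω)
  obtain ⟨x, y, hxy⟩ : ∃ x y : Ω, q x ≠ q y := by
    by_contra! hc
    refine hA ⟨fun x y => ?_⟩
    have := Quotient.eq''.1 (hc y x)
    exact MulAction.orbitRel_apply.1 this
  have hlt := card_fiber_lt q hxy
  refine (ChainWeightLE.of_invariant_partition q (fun a x => ?_) fun i => h _ (hlt i)).mono ?_
  · exact Quotient.eq''.2 (MulAction.orbitRel_apply.2 (MulAction.mem_orbit x a))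
  · refine le_trans ?_ (le_chainBound _)
    have h1 : ∀ i, chainBound (Nat.card {x // q x = i}) + 3 ≤ 3 * Nat.card {x // q x = i} := by
      intro i
      have : 0 < Nat.card {x // q x = i} := by
        obtain ⟨z, hz⟩ := hqs i
        have : Nonempty {x // q x = i} := ⟨⟨z, hz⟩⟩
        exact Nat.card_pos
      have := chainBound_le (Nat.card {x // q x = i})
      omega
    have h2 := Finset.sum_le_sum fun i (_ : i ∈ Finset.univ) => h1 i
    rw [Finset.sum_add_distrib, ← Finset.mul_sum, sum_card_fiber, Finset.sum_const,
      Finset.card_univ, smul_eq_mul] at h2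
    have h3 : 1 < Fintype.card (MulAction.orbitRel.Quotient A Ω) :=
      Fintype.one_lt_card_iff.2 ⟨_, _, hxy⟩
    omega

open scoped Pointwise in
theorem ChainWeightLE.of_not_isPreprimitive {A Ω : Type u} [Group A] [Finite A] [MulAction A Ω]
    [FaithfulSMul A Ω] [Finite Ω] (h : ∀ m < Nat.card Ω, ActionBound.{u} m)
    [MulAction.IsPretransitive A Ω]
    (hA : ¬ MulAction.IsPreprimitive A Ω) : ChainWeightLE A (chainBound (Nat.card Ω)) := by
  classical
  obtain ⟨B, hB, hBt⟩ : ∃ B : Set Ω, MulAction.IsBlock A B ∧ ¬ MulAction.IsTrivialBlock B := by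
    by_contra! hc
    exact hA ⟨fun {B} hB => hc B hB⟩
  rw [MulAction.IsTrivialBlock, not_or, Set.not_subsingleton_iff] at hBt
  obtain ⟨hB1, hB2⟩ := hBt
  have hmul := hB.ncard_block_mul_ncard_orbit_eq hB1.nonempty
  let O := MulAction.orbit A B
  have hO : Nat.card O = Set.ncard O := rfl
  have : Fintype O := Fintype.ofFinite O
  have hb1 : 1 < B.ncard := (Set.one_lt_ncard_iff_nontrivial).2 hB1
  have hpos : 0 < Nat.card Ω := by
    have : Nonempty Ω := ⟨hB1.nonempty.some⟩
    exact Nat.card_pos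
  have hb2 : B.ncard < Nat.card Ω := by
    rw [← Set.ncard_univ]
    exact Set.ncard_lt_ncard (Set.ssubset_univ_iff.2 hB2)
  have hk1 : 1 < Nat.card O := by
    rw [hO]
    by_contra! hc
    have : B.ncard * Set.ncard O ≤ B.ncard * 1 := Nat.mul_le_mul_left _ hc
    have : B.ncard * Set.ncard O = Nat.card Ω := hmul
    omega
  have hk2 : Nat.card O < Nat.card Ω := by
    have : B.ncard * Nat.card O = Nat.card Ω := hmul
    nlinarith
  have hex : ∀ x : Ω, ∃ c : O, x ∈ (c : Set Ω) := by
    intro x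
    obtain ⟨b, hb⟩ := hB1.nonempty
    obtain ⟨g, rfl⟩ := MulAction.exists_smul_eq A b x
    exact ⟨⟨g • B, MulAction.mem_orbit _ _⟩, Set.smul_mem_smul_set hb⟩
  choose q hq using hex
  have huniq : ∀ (x : Ω) (c : O), x ∈ (c : Set Ω) → q x = c := by
    rintro x ⟨c, g, rfl⟩ hx
    have h1 := hq x
    obtain ⟨g', hg'⟩ := (q x).2
    apply Subtype.ext
    rw [← hg'] at h1 ⊢
    by_contra hne
    exact Set.disjoint_left.1 (hB hne) h1 hx
  have hfib : ∀ c : O, Nat.card {x // q x = c} = B.ncard := by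
    rintro ⟨c, g, rfl⟩
    have : {x | q x = ⟨g • B, g, rfl⟩} = g • B := by
      ext x
      constructor
      · intro hx
        have := hq x
        rw [hx] at this
        exact this
      · exact fun hx => huniq x _ hx
    calc _ = Set.ncard {x | q x = ⟨g • B, g, rfl⟩} := rfl
      _ = _ := by rw [this, Set.ncard_smul_set]
  let f : A →* Equiv.Perm O := MulAction.toPermHom A O
  have h1 : ChainWeightLE f.range (chainBound (Nat.card O)) := (h _ hk2).perm _
  have h2 : ChainWeightLE f.ker (∑ c : O, chainBound (Nat.card {x // q x = c})) := by
    refine ChainWeightLE.of_invariant_partition q (fun a x => ?_) fun i => ?_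
    · refine huniq _ _ ?_
      have ha : (a : A) • q x = q x := by
        have := congrArg (fun e : Equiv.Perm O => e (q x)) (MonoidHom.mem_ker.1 a.2)
        exact this
      rw [← ha]
      exact Set.smul_mem_smul_set (hq x)
    · rw [hfib]; exact h _ hb2
  refine (ChainWeightLE.of_hom f h1 h2).mono ?_
  rw [Finset.sum_congr rfl fun c _ => by rw [hfib c], Finset.sum_const, Finset.card_univ,
    ← Nat.card_eq_fintype_card, smul_eq_mul]
  have h7 : Nat.card Ω ≠ 7 := by
    intro h7
    have h8 : B.ncard ∣ 7 := ⟨Nat.card O, by rw [← h7]; exact hmul.symm⟩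
    rcases (Nat.dvd_prime (by norm_num)).1 h8 with h9 | h9 <;> omega
  have h3 := chainBound_le (Nat.card O)
  have h4 := chainBound_le B.ncard
  have h5 : B.ncard * Nat.card O = Nat.card Ω := hmul
  have h6 : chainBound (Nat.card Ω) = 3 * (Nat.card Ω - 1) := by
    rw [chainBound, if_neg h7]
  rw [h6, ← h5]
  clear h5 h6
  have h10 := Nat.mul_le_mul_left (Nat.card O) h4
  obtain ⟨b, hb⟩ : ∃ b, B.ncard = b + 1 := ⟨B.ncard - 1, by omega⟩
  obtain ⟨k, hk⟩ : ∃ k, Nat.card O = k + 1 := ⟨Nat.card O - 1, by omega⟩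
  rw [hk] at h3
  rw [hb, hk] at h10 ⊢
  simp only [Nat.add_sub_cancel] at h3 h10
  have : (b + 1) * (k + 1) - 1 = b * k + b + k := by
    have : (b + 1) * (k + 1) = b * k + b + k + 1 := by ring
    omega
  rw [this]
  nlinarith

end

theorem card_mulAut_eq_cardGL {E : Type*} [CommGroup E] [Finite E] {p a : ℕ} [Fact p.Prime]
    (hE : ∀ x : E, x ^ p = 1) (hc : Nat.card E = p ^ a) :
    Nat.card (MulAut E) = cardGL p a := by
  let : Module (ZMod p) (Additive E) := AddCommGroup.zmodModule (n := p) fun x => hE x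
  have : Finite (Additive E) := inferInstanceAs (Finite E)
  have hrank : Module.finrank (ZMod p) (Additive E) = a := by
    have h := Module.natCard_eq_pow_finrank (K := ZMod p) (V := Additive E)
    rw [Nat.card_zmod, show Nat.card (Additive E) = Nat.card E from rfl, hc] at h
    exact (Nat.pow_right_injective (Fact.out : p.Prime).two_le h).symm
  let e1 : MulAut E ≃ (Additive E ≃+ Additive E) := MulEquiv.toAdditive
  let e2 : (Additive E ≃+ Additive E) ≃ (Additive E ≃ₗ[ZMod p] Additive E) :=
    { toFun := fun e => e.toLinearEquiv fun c x => ZMod.map_smul e.toAddMonoidHom c x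
      invFun := fun e => e.toAddEquiv
      left_inv := fun e => rfl
      right_inv := fun e => rfl }
  let b : Module.Basis (Fin a) (ZMod p) (Additive E) := Module.finBasisOfFinrankEq _ _ hrank
  let e3 : (Additive E ≃ₗ[ZMod p] Additive E) ≃ GL (Fin a) (ZMod p) :=
    (LinearMap.GeneralLinearGroup.generalLinearEquiv (ZMod p) (Additive E)).symm.toEquiv.trans
      (Units.mapEquiv (LinearMap.toMatrixAlgEquiv b).toMulEquiv).toEquiv
  rw [Nat.card_congr (e1.trans (e2.trans e3)), Matrix.card_GL_field, ZMod.card, cardGL,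
    Finset.prod_range]

theorem ChainWeightLE.of_bot {A : Type*} [Group A] {c : ℕ}
    (h : ∀ (r : ℕ) (L : ℕ → Subgroup A) (p : ℕ → ℕ), Monotone L → (∀ i, (L i).Normal) →
      (∀ i, (p i).Prime) → L 0 = ⊥ →
      ∑ i ∈ Finset.range r, wt (p i) * ((L i).relIndex (L (i + 1))).factorization (p i) ≤ c) :
    ChainWeightLE A c := by
  intro L p r hm hn hp
  refine le_trans ?_ (h (r + 1) (fun i => i.casesOn ⊥ L) (fun i => i.casesOn 2 p) ?_ ?_ ?_ rfl)
  · rw [Finset.sum_range_succ']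
    exact Nat.le_add_right _ _
  · refine monotone_nat_of_le_succ fun i => ?_
    cases i with
    | zero => exact bot_le
    | succ i => exact hm (Nat.le_succ i)
  · intro i
    cases i with
    | zero => exact Subgroup.normal_bot
    | succ i => exact hn i
  · intro i
    cases i with
    | zero => exact Nat.prime_two
    | succ i => exact hp i

/-- A nontrivial normal `p`-subgroup of a primitive permutation group is a regular elementary
abelian group. -/
theorem primitive_normal_pgroup {A Ω : Type*} [Group A] [Finite A] [MulAction A Ω]
    [FaithfulSMul A Ω] [MulAction.IsPreprimitive A Ω] {p : ℕ} [Fact p.Prime] (P : Subgroup A)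
    [P.Normal] (hP : IsPGroup p P) (hne : P ≠ ⊥) :
    (∀ x ∈ P, ∀ y ∈ P, x * y = y * x) ∧ (∀ x ∈ P, x ^ p = 1) ∧
      (∀ x : Ω, Function.Bijective fun a : P => a • x) := by
  let Z : Subgroup A :=
    { carrier := {z | z ∈ P ∧ (∀ y ∈ P, z * y = y * z) ∧ z ^ p = 1}
      one_mem' := ⟨P.one_mem, by simp, one_pow p⟩
      mul_mem' := by
        rintro a b ⟨ha, ha1, ha2⟩ ⟨hb, hb1, hb2⟩
        refine ⟨P.mul_mem ha hb, fun y hy => ?_, ?_⟩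
        · rw [mul_assoc, hb1 y hy, ← mul_assoc, ha1 y hy, mul_assoc]
        · rw [Commute.mul_pow (ha1 b hb), ha2, hb2, one_mul]
      inv_mem' := by
        rintro a ⟨ha, ha1, ha2⟩
        refine ⟨P.inv_mem ha, fun y hy => ?_, by rw [inv_pow, ha2, inv_one]⟩
        rw [inv_mul_eq_iff_eq_mul, ← mul_assoc, ha1 y hy, mul_assoc, mul_inv_cancel, mul_one] }
  have hZP : Z ≤ P := fun z hz => hz.1
  have hZn : Z.Normal := by
    refine ⟨fun z hz g => ⟨‹P.Normal›.conj_mem z hz.1 g, fun y hy => ?_, ?_⟩⟩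
    · have h1 := hz.2.1 (g⁻¹ * y * g) (by simpa using ‹P.Normal›.conj_mem y hy g⁻¹)
      calc g * z * g⁻¹ * y = g * (z * (g⁻¹ * y * g)) * g⁻¹ := by group
        _ = _ := by rw [h1]; group
    · rw [conj_pow, hz.2.2, mul_one, mul_inv_cancel]
  have hZne : Z ≠ ⊥ := by
    have : Nontrivial P := (Subgroup.nontrivial_iff_ne_bot P).2 hne
    have hc := hP.center_nontrivial
    have hcp : IsPGroup p (Subgroup.center P) := hP.to_subgroup _
    have hdvd : p ∣ Nat.card (Subgroup.center P) := by
      obtain ⟨n, hn, hcard⟩ := hcp.nontrivial_iff_card.1 hc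
      rw [hcard]
      exact dvd_pow_self p hn.ne'
    obtain ⟨z, hz⟩ := exists_prime_orderOf_dvd_card' p hdvd
    intro hbot
    have hzm : ((z : P) : A) ∈ Z := by
      refine ⟨(z : P).2, fun y hy => ?_, ?_⟩
      · exact (congrArg Subtype.val (Subgroup.mem_center_iff.1 z.2 ⟨y, hy⟩)).symm
      · have := pow_orderOf_eq_one z
        rw [hz] at this
        exact congrArg (fun w : Subgroup.center P => ((w : P) : A)) this
    rw [hbot, Subgroup.mem_bot] at hzm
    have : z = 1 := Subtype.ext (Subtype.ext hzm)
    rw [this, orderOf_one] at hz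
    exact (Fact.out : p.Prime).one_lt.ne hz
  have hfix : MulAction.fixedPoints Z Ω ≠ Set.univ := by
    intro hf
    refine hZne (le_antisymm (fun z hz => ?_) bot_le)
    refine Subgroup.mem_bot.2 (FaithfulSMul.eq_of_smul_eq_smul (α := Ω) fun x => ?_)
    rw [one_smul]
    exact (hf ▸ Set.mem_univ x : x ∈ MulAction.fixedPoints Z Ω) ⟨z, hz⟩
  have htrans : MulAction.IsPretransitive Z Ω :=
    MulAction.IsQuasiPreprimitive.isPretransitive_of_normal hfix
  have hinj : ∀ x : Ω, ∀ a ∈ P, a • x = x → a = 1 := by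
    intro x a ha hax
    refine FaithfulSMul.eq_of_smul_eq_smul (α := Ω) fun y => ?_
    obtain ⟨z, rfl⟩ := MulAction.exists_smul_eq Z x y
    rw [one_smul]
    calc a • (z : A) • x = (z : A) • a • x := by rw [smul_smul, ← z.2.2.1 a ha, mul_smul]
      _ = _ := by rw [hax]; rfl
  have hPZ : ∀ a ∈ P, a ∈ Z := by
    intro a ha
    obtain ⟨x⟩ : Nonempty Ω := by
      by_contra hne'
      rw [not_nonempty_iff] at hne'
      exact hfix (Subsingleton.elim _ _)
    obtain ⟨z, hz⟩ := MulAction.exists_smul_eq Z x (a • x)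
    have := hinj x ((z : A)⁻¹ * a) (P.mul_mem (P.inv_mem (hZP z.2)) ha) (by
      rw [mul_smul, ← hz]
      exact inv_smul_smul (z : A) x)
    rw [inv_mul_eq_one] at this
    exact this ▸ z.2
  refine ⟨fun x hx y hy => (hPZ x hx).2.1 y hy, fun x hx => (hPZ x hx).2.2, fun x => ⟨?_, ?_⟩⟩
  · intro a b hab
    have := hinj x ((b : A)⁻¹ * a) (P.mul_mem (P.inv_mem b.2) a.2) (by
      rw [mul_smul, inv_smul_eq_iff]
      exact hab)
    exact Subtype.ext (inv_mul_eq_one.1 this).symm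
  · intro y
    obtain ⟨z, hz⟩ := MulAction.exists_smul_eq Z x y
    exact ⟨⟨z, hZP z.2⟩, hz⟩

section

universe u

theorem ChainWeightLE.stabilizer_of_faithful {A Ω : Type u} [Group A] [Finite A] [MulAction A Ω]
    [FaithfulSMul A Ω] [Finite Ω] (h : ∀ m < Nat.card Ω, ActionBound.{u} m) (x : Ω) :
    ChainWeightLE (MulAction.stabilizer A x) (chainBound (Nat.card Ω - 1)) := by
  have hcard : Nat.card {y // y ≠ x} = Nat.card Ω - 1 := by
    have := Set.ncard_add_ncard_compl ({x} : Set Ω)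
    rw [Set.ncard_singleton] at this
    have h2 : Set.ncard ({x}ᶜ : Set Ω) = Nat.card {y // y ≠ x} := rfl
    omega
  have hlt : Nat.card {y // y ≠ x} < Nat.card Ω := by
    have : Nonempty Ω := ⟨x⟩
    have := Nat.card_pos (α := Ω)
    omega
  rw [← hcard]
  refine ChainWeightLE.of_injective (restrHom (X := Ω) (fun y => y ≠ x) fun a y => ?_) ?_
    fun C => (h _ hlt).perm C
  · refine not_congr ⟨fun hy => ?_, fun hy => ?_⟩
    · have : a • y = a • x := hy.trans a.2.symm
      exact smul_left_cancel a this
    · rw [hy]; exact a.2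
  · refine (injective_iff_map_eq_one _).2 fun a ha => ?_
    have h1 := (mem_ker_restrHom _ _ a).1 (MonoidHom.mem_ker.2 ha)
    apply Subtype.ext
    refine FaithfulSMul.eq_of_smul_eq_smul (α := Ω) fun y => ?_
    rw [Subgroup.coe_one, one_smul]
    by_cases hy : y = x
    · rw [hy]; exact a.2
    · exact h1 y hy

theorem affine_stabilizer_bound {A Ω : Type u} [Group A] [Finite A] [MulAction A Ω]
    [FaithfulSMul A Ω] [Finite Ω] [MulAction.IsPreprimitive A Ω]
    (h : ∀ m < Nat.card Ω, ActionBound.{u} m) {p : ℕ} [hp : Fact p.Prime] (P : Subgroup A)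
    [P.Normal] (hP : IsPGroup p P) (hne : P ≠ ⊥) (x : Ω) :
    ∃ c, ChainWeightLE (MulAction.stabilizer A x) c ∧
      wt p * (Nat.card P).factorization p + c ≤ chainBound (Nat.card Ω) := by
  obtain ⟨hcomm, hpow, hbij⟩ := primitive_normal_pgroup P hP hne (Ω := Ω)
  have : Nontrivial P := (Subgroup.nontrivial_iff_ne_bot P).2 hne
  obtain ⟨a, ha, hcard⟩ := hP.nontrivial_iff_card.1 this
  have hΩ : Nat.card Ω = p ^ a := by rw [← hcard, Nat.card_congr (Equiv.ofBijective _ (hbij x))]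
  rw [hΩ, hcard, hp.out.factorization_pow, Finsupp.single_eq_same]
  by_cases h8 : p ^ a = 8
  · refine ⟨_, ChainWeightLE.stabilizer_of_faithful h x, ?_⟩
    have hp2 : p = 2 := by
      have : p ∣ 2 ^ 3 := by
        rw [show 2 ^ 3 = 8 by norm_num, ← h8]
        exact dvd_pow_self p ha.ne'
      exact (Nat.prime_dvd_prime_iff_eq hp.out Nat.prime_two).1 (hp.out.dvd_of_dvd_pow this)
    subst hp2
    have ha3 : a = 3 := Nat.pow_right_injective le_rfl (h8.trans (by norm_num : 8 = 2 ^ 3))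
    subst ha3
    rw [hΩ]
    decide
  · refine ⟨_, chainWeightLE_totalWt _, le_trans (Nat.add_le_add_left ?_ _)
      (affWt_le_chainBound hp.out a ha.ne' h8)⟩
    refine totalWt_le_of_dvd ?_ (cardGL_ne_zero hp.out.two_le a)
    let : CommGroup P :=
      { (inferInstance : Group P) with
        mul_comm := fun y z => Subtype.ext (hcomm y y.2 z z.2) }
    have hmul := card_mulAut_eq_cardGL (E := P) (fun y => Subtype.ext (hpow y y.2)) hcard
    have hinj : Function.Injective
        ((MulAut.conjNormal (H := P)).comp (MulAction.stabilizer A x).subtype) := by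
      refine (injective_iff_map_eq_one _).2 fun g hg => ?_
      apply Subtype.ext
      refine FaithfulSMul.eq_of_smul_eq_smul (α := Ω) fun y => ?_
      obtain ⟨z, rfl⟩ := (hbij x).2 y
      have h1 : (g : A) * z * (g : A)⁻¹ = z := by
        have := congrArg (fun e : MulAut P => ((e z : P) : A)) hg
        simpa using this
      rw [Subgroup.coe_one, one_smul]
      calc (g : A) • (z : A) • x = ((g : A) * z * (g : A)⁻¹) • (g : A) • x := by
            rw [smul_smul, smul_smul]; group
        _ = (z : A) • x := by rw [h1, show (g : A) • x = x from g.2]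
    have hd := Subgroup.card_dvd_of_injective _ hinj
    rwa [← hmul]

theorem ChainWeightLE.of_isPreprimitive {A Ω : Type u} [Group A] [Finite A] [MulAction A Ω]
    [FaithfulSMul A Ω] [Finite Ω] [MulAction.IsPreprimitive A Ω]
    (h : ∀ m < Nat.card Ω, ActionBound.{u} m)
    (h' : ∀ Y : Subgroup A, Y ≠ ⊤ → ChainWeightLE Y (chainBound (Nat.card Ω))) :
    ChainWeightLE A (chainBound (Nat.card Ω)) := by
  refine ChainWeightLE.of_bot fun r => ?_
  induction r with
  | zero => intro L p _ _ _ _; simp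
  | succ r ih =>
    intro L p hm hn hp h0
    by_cases hz : ((L 0).relIndex (L 1)).factorization (p 0) = 0
    · rw [Finset.sum_range_succ', hz, mul_zero, add_zero]
      refine le_trans (Finset.sum_le_sum fun i _ => ?_)
        (ih (fun i => i.casesOn ⊥ fun i => L (i + 2)) (fun i => p (i + 1)) ?_ ?_
          (fun i => hp _) rfl)
      · cases i with
        | zero =>
          refine Nat.mul_le_mul_left _ ?_
          change ((L 1).relIndex (L 2)).factorization (p 1) ≤
            ((⊥ : Subgroup A).relIndex (L 2)).factorization (p 1)
          refine (Nat.factorization_le_iff_dvd ?_ ?_).2 ?_ (p 1)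
          · exact Subgroup.index_ne_zero_of_finite
          · exact Subgroup.index_ne_zero_of_finite
          · rw [← Subgroup.relIndex_mul_relIndex ⊥ (L 1) (L 2) bot_le (hm (by norm_num))]
            exact dvd_mul_left _ _
        | succ i => exact le_rfl
      · refine monotone_nat_of_le_succ fun i => ?_
        cases i with
        | zero => exact bot_le
        | succ i => exact hm (by omega)
      · intro i
        cases i with
        | zero => exact Subgroup.normal_bot
        | succ i => exact hn _
    · have : Fact (p 0).Prime := ⟨hp 0⟩
      have hnN := hn 1
      have hK : ∀ i, (L (i + 1)).Normal := fun i => hn _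
      obtain ⟨P⟩ : Nonempty (Sylow (p 0) (L 1)) := inferInstance
      set P' : Subgroup A := (P : Subgroup (L 1)).map (L 1).subtype with hP'
      have hcardP : Nat.card P' = Nat.card P :=
        Nat.card_congr ((P : Subgroup (L 1)).equivMapOfInjective _
          (L 1).subtype_injective).symm.toEquiv
      have hfac : (Nat.card P').factorization (p 0) =
          ((L 0).relIndex (L 1)).factorization (p 0) := by
        rw [hcardP, P.card_eq_multiplicity, (hp 0).factorization_pow, Finsupp.single_eq_same, h0,
          Subgroup.relIndex_bot_left]
      have hP1 : P' ≤ L 1 := Subgroup.map_subtype_le _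
      have hfrat := Sylow.normalizer_sup_eq_top P
      rw [← hP', sup_comm] at hfrat
      -- passing from `A` to a supplement of `L 1`
      have hsup : ∀ Y : Subgroup A, L 1 ⊔ Y = ⊤ → ∀ i,
          (((L (i + 1)).subgroupOf Y).relIndex ((L (i + 1 + 1)).subgroupOf Y)) =
            (L (i + 1)).relIndex (L (i + 1 + 1)) := by
        intro Y hY i
        refine relIndex_subgroupOf_of_sup_eq_top ?_ (hm (by omega))
        rw [eq_top_iff, ← hY]
        exact sup_le_sup_right (hm (by omega)) _
      by_cases hY : Subgroup.normalizer (P' : Set A) = ⊤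
      · have hPn : P'.Normal := Subgroup.normalizer_eq_top_iff.1 hY
        have hne : P' ≠ ⊥ := by
          intro hbot
          rw [← hfac, hbot] at hz
          simp at hz
        have hPp : IsPGroup (p 0) P' := P.2.map _
        obtain ⟨hcomm, hpow, hbij⟩ := primitive_normal_pgroup P' hPp hne (Ω := Ω)
        obtain ⟨x⟩ : Nonempty Ω := by
          by_contra hne'
          rw [not_nonempty_iff] at hne'
          refine hne (le_antisymm (fun z hz => ?_) bot_le)
          exact Subgroup.mem_bot.2 (FaithfulSMul.eq_of_smul_eq_smul (α := Ω) fun x => isEmptyElim x)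
        obtain ⟨c, hc, hle⟩ := affine_stabilizer_bound h P' hPp hne x
        have htop : L 1 ⊔ MulAction.stabilizer A x = ⊤ := by
          refine eq_top_iff.2 fun g _ => ?_
          obtain ⟨z, hz⟩ := (hbij x).2 (g • x)
          have : g = z * ((z : A)⁻¹ * g) := by group
          rw [this]
          refine Subgroup.mul_mem_sup (hP1 z.2) ?_
          rw [MulAction.mem_stabilizer_iff, mul_smul, ← hz]
          exact inv_smul_smul (z : A) x
        have hrest := hc (fun i => (L (i + 1)).subgroupOf (MulAction.stabilizer A x))
          (fun i => p (i + 1)) r (fun i j hij => Subgroup.comap_mono (hm (by omega)))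
          (fun i => (hn _).comap _) (fun i => hp _)
        simp only [hsup _ htop] at hrest
        rw [Finset.sum_range_succ', zero_add, ← hfac]
        omega
      · refine le_trans (le_of_eq ?_) (h' _ hY
          (fun i => i.casesOn ⊥ fun i => (L (i + 1)).subgroupOf (Subgroup.normalizer (P' : Set A)))
          p (r + 1) ?_ ?_ hp)
        · rw [Finset.sum_range_succ', Finset.sum_range_succ']
          congr 1
          · refine Finset.sum_congr rfl fun i _ => ?_
            rw [← hsup _ hfrat i]
          · congr 1
            change _ = ((⊥ : Subgroup _).relIndex ((L 1).subgroupOf _)).factorization (p 0)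
            rw [zero_add]
            have hle : (P'.subgroupOf (Subgroup.normalizer (P' : Set A))) ≤
              (L 1).subgroupOf (Subgroup.normalizer (P' : Set A)) := Subgroup.comap_mono hP1
            have e1 : Nat.card (P'.subgroupOf (Subgroup.normalizer (P' : Set A))) = Nat.card P' :=
              Nat.card_congr (Subgroup.subgroupOfEquivOfLe P'.le_normalizer).toEquiv
            have e2 := Subgroup.card_dvd_of_le hle
            have e3 : Nat.card ((L 1).subgroupOf (Subgroup.normalizer (P' : Set A))) ∣
                Nat.card (L 1) := by
              exact Subgroup.card_comap_dvd_of_injective _ _ (Subgroup.subtype_injective _)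
            rw [Subgroup.relIndex_bot_left, h0, Subgroup.relIndex_bot_left]
            rw [h0, Subgroup.relIndex_bot_left] at hfac
            refine le_antisymm ?_
              ((Nat.factorization_le_iff_dvd Nat.card_pos.ne' Nat.card_pos.ne').2 e3 _)
            rw [← hfac, ← e1]
            exact (Nat.factorization_le_iff_dvd Nat.card_pos.ne' Nat.card_pos.ne').2 e2 _
        · refine monotone_nat_of_le_succ fun i => ?_
          cases i with
          | zero => exact bot_le
          | succ i => exact Subgroup.comap_mono (hm (by omega))
        · intro i
          cases i with
          | zero => exact Subgroup.normal_bot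
          | succ i => exact (hn _).comap _

theorem actionBound (m : ℕ) : ActionBound.{u} m := by
  induction m using Nat.strong_induction_on with
  | _ m ih =>
    have key : ∀ n, ∀ (A Ω : Type u) [Group A] [Finite A] [MulAction A Ω] [FaithfulSMul A Ω]
        [Finite Ω], Nat.card A = n → Nat.card Ω = m → ChainWeightLE A (chainBound m) := by
      intro n
      induction n using Nat.strong_induction_on with
      | _ n ihn =>
        intro A Ω _ _ _ _ _ hA hΩ
        subst hA hΩ
        by_cases ht : MulAction.IsPretransitive A Ω
        · by_cases hpr : MulAction.IsPreprimitive A Ω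
          · refine ChainWeightLE.of_isPreprimitive ih fun Y hY => ?_
            refine ihn (Nat.card Y) ?_ Y Ω rfl rfl
            refine lt_of_le_of_ne (Subgroup.card_le_card_group Y) fun hc => hY ?_
            exact Subgroup.eq_top_of_card_eq Y hc
          · exact ChainWeightLE.of_not_isPreprimitive ih hpr
        · exact ChainWeightLE.of_not_isPretransitive ih ht
    intro A Ω _ _ _ _ _ hΩ
    exact key _ A Ω rfl hΩ

end

theorem exists_normal_of_relIndex_eq_six {A : Type*} [Group A] {K N : Subgroup A}
    [hK : K.Normal] [hN : N.Normal] (hKN : K ≤ N) (h6 : K.relIndex N = 6) :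
    ∃ M : Subgroup A, M.Normal ∧ K ≤ M ∧ M ≤ N ∧ K.relIndex M = 3 ∧ M.relIndex N = 2 := by
  have hcard : Nat.card (N ⧸ K.subgroupOf N) = 6 := h6
  have hfin : Finite (N ⧸ K.subgroupOf N) := Nat.finite_of_card_ne_zero (by omega)
  have : Fact (Nat.Prime 3) := ⟨Nat.prime_three⟩
  obtain ⟨t, ht⟩ := exists_prime_orderOf_dvd_card' (G := N ⧸ K.subgroupOf N) 3 (by omega)
  have hTcard : Nat.card (Subgroup.zpowers t) = 3 := by rw [Nat.card_zpowers, ht]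
  have hTindex : (Subgroup.zpowers t).index = 2 := by
    have := (Subgroup.zpowers t).card_mul_index
    rw [hTcard, hcard] at this
    omega
  have hmem : ∀ q : N ⧸ K.subgroupOf N, q ∈ Subgroup.zpowers t ↔ q ^ 3 = 1 := by
    intro q
    constructor
    · intro hq
      have := pow_card_eq_one' (x := (⟨q, hq⟩ : Subgroup.zpowers t))
      rw [hTcard] at this
      exact congrArg Subtype.val this
    · intro hq
      have h2 : q ^ 2 ∈ Subgroup.zpowers t := Subgroup.sq_mem_of_index_two hTindex q
      have : q = (q ^ 2)⁻¹ := by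
        rw [eq_inv_iff_mul_eq_one, ← pow_succ', hq]
      rw [this]
      exact inv_mem h2
  have hcomap : ∀ x : N, x ∈ (Subgroup.zpowers t).comap (QuotientGroup.mk' (K.subgroupOf N)) ↔
      (x : A) ^ 3 ∈ K := by
    intro x
    rw [Subgroup.mem_comap, hmem, ← map_pow, QuotientGroup.mk'_apply, QuotientGroup.eq_one_iff,
      Subgroup.mem_subgroupOf]
    rfl
  set S := (Subgroup.zpowers t).comap (QuotientGroup.mk' (K.subgroupOf N)) with hS
  have hSM : ∀ x : A, x ∈ S.map N.subtype ↔ x ∈ N ∧ x ^ 3 ∈ K := by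
    intro x
    constructor
    · rintro ⟨y, hy, rfl⟩
      exact ⟨y.2, (hcomap y).1 hy⟩
    · rintro ⟨h1, h2⟩
      exact ⟨⟨x, h1⟩, (hcomap ⟨x, h1⟩).2 h2, rfl⟩
  have hKM : K ≤ S.map N.subtype := fun x hx => (hSM x).2 ⟨hKN hx, pow_mem hx 3⟩
  have hMN : S.map N.subtype ≤ N := Subgroup.map_subtype_le _
  have hM2 : (S.map N.subtype).relIndex N = 2 := by
    rw [Subgroup.relIndex, Subgroup.subgroupOf,
      Subgroup.comap_map_eq_self_of_injective N.subtype_injective, hS,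
      Subgroup.index_comap_of_surjective _ (QuotientGroup.mk'_surjective _), hTindex]
  refine ⟨S.map N.subtype, ⟨fun x hx g => ?_⟩, hKM, hMN, ?_, hM2⟩
  · rw [hSM] at hx ⊢
    exact ⟨hN.conj_mem x hx.1 g, by rw [conj_pow]; exact hK.conj_mem _ hx.2 g⟩
  · have := Subgroup.relIndex_mul_relIndex K _ N hKM hMN
    rw [hM2, h6] at this
    omega

theorem exists_chain_costs.{u} {A Ω : Type u} [Group A] [Finite A] [MulAction A Ω]
    [FaithfulSMul A Ω] [Finite Ω] {β : ℕ} (hβ : 5 ≤ β) (hm : 3 * (Nat.card Ω - 1) < 2 ^ β)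
    (L : ℕ → Subgroup A) (hL : Monotone L) (hn : ∀ i, (L i).Normal) (r : ℕ) :
    ∃ s : ℕ → ℕ, (∀ j, BreakCost β (s j) ((L j).relIndex (L (j + 1)))) ∧
      2 * ∑ j ∈ Finset.range r, s j ≤ 3 * (Nat.card Ω - 1) := by
  have hA : ChainWeightLE A (3 * (Nat.card Ω - 1)) :=
    (actionBound (Nat.card Ω) A Ω rfl).mono (chainBound_le _)
  have hstep : ∀ j, ∃ (M : Subgroup A) (p q s : ℕ), M.Normal ∧ L j ≤ M ∧ M ≤ L (j + 1) ∧
      p.Prime ∧ q.Prime ∧ BreakCost β s ((L j).relIndex (L (j + 1))) ∧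
      2 * s ≤ wt p * ((L j).relIndex M).factorization p +
        wt q * (M.relIndex (L (j + 1))).factorization q := by
    intro j
    have hne : (L j).relIndex (L (j + 1)) ≠ 0 := Subgroup.index_ne_zero_of_finite
    have hle := hL (Nat.le_succ j)
    have hnj := hn j
    have hnj1 := hn (j + 1)
    by_cases h1 : (L j).relIndex (L (j + 1)) = 1
    · refine ⟨L j, 2, 2, 0, hn j, le_rfl, hle, Nat.prime_two, Nat.prime_two, ?_, by simp⟩
      rw [h1]
      exact BreakCost.one 0
    by_cases h6 : (L j).relIndex (L (j + 1)) = 6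
    · obtain ⟨M, hM, hjM, hMj, e3, e2⟩ := exists_normal_of_relIndex_eq_six hle h6
      refine ⟨M, 3, 2, 2, hM, hjM, hMj, Nat.prime_three, Nat.prime_two, ?_, ?_⟩
      · rw [h6]
        exact breakCost_two hβ 6 (by norm_num) (by norm_num)
      · rw [e3, e2, Nat.prime_three.factorization_self, Nat.prime_two.factorization_self]
        decide
    · obtain ⟨s, p, hp, hs, hsp⟩ := exists_cost hβ (by omega) h6 (fun p hp => by
        have := hA (fun i => L (j + i)) (fun _ => p) 1 (fun a b hab => hL (by omega))
          (fun i => hn _) (fun _ => hp)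
        simpa using this) hm
      refine ⟨L j, 2, p, s, hn j, le_rfl, hle, Nat.prime_two, hp, hs, ?_⟩
      omega
  choose M p q s hM hjM hMj hp hq hs hsum using hstep
  refine ⟨s, hs, ?_⟩
  have key := hA (fun i => if i % 2 = 0 then L (i / 2) else M (i / 2))
    (fun i => if i % 2 = 0 then p (i / 2) else q (i / 2)) (2 * r) ?_ ?_ ?_
  · refine le_trans ?_ key
    clear key
    induction r with
    | zero => simp
    | succ r ih =>
      rw [Finset.sum_range_succ, mul_add, mul_add, mul_one, Finset.sum_range_succ,
        Finset.sum_range_succ, add_assoc]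
      refine add_le_add ih ?_
      have e1 : 2 * r % 2 = 0 := by omega
      have e2 : (2 * r + 1) % 2 ≠ 0 := by omega
      have e3 : 2 * r / 2 = r := by omega
      have e4 : (2 * r + 1) / 2 = r := by omega
      have e5 : (2 * r + 1 + 1) % 2 = 0 := by omega
      have e6 : (2 * r + 1 + 1) / 2 = r + 1 := by omega
      simp only [if_pos e1, if_neg e2, if_pos e5, e3, e4, e6]
      exact hsum r
  · refine monotone_nat_of_le_succ fun i => ?_
    rcases Nat.even_or_odd' i with ⟨k, rfl | rfl⟩
    · have e1 : 2 * k % 2 = 0 := by omega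
      have e2 : (2 * k + 1) % 2 ≠ 0 := by omega
      have e3 : 2 * k / 2 = k := by omega
      have e4 : (2 * k + 1) / 2 = k := by omega
      simp only [if_pos e1, if_neg e2, e3, e4]
      exact hjM k
    · have e2 : (2 * k + 1) % 2 ≠ 0 := by omega
      have e4 : (2 * k + 1) / 2 = k := by omega
      have e5 : (2 * k + 1 + 1) % 2 = 0 := by omega
      have e6 : (2 * k + 1 + 1) / 2 = k + 1 := by omega
      simp only [if_neg e2, if_pos e5, e4, e6]
      exact hMj k
  · intro i
    split_ifs
    · exact hn _
    · exact hM _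
  · intro i
    split_ifs
    · exact hp _
    · exact hq _

theorem normal_fixingSubgroup {A X : Type*} [Group A] [MulAction A X] (S : Set X)
    (hS : ∀ (a : A) x, a • x ∈ S ↔ x ∈ S) : (fixingSubgroup A S).Normal := by
  refine ⟨fun a ha g => ?_⟩
  rw [mem_fixingSubgroup_iff] at ha ⊢
  intro x hx
  rw [mul_smul, mul_smul, ha _ ((hS _ _).2 hx), smul_inv_smul]

theorem exists_breaking_sets_of_finite.{u} {A X : Type u} [Group A] [Finite A] [MulAction A X]
    [FaithfulSMul A X] [Finite X] (S : ℕ → Set X) (hS : ∀ t (a : A) x, a • x ∈ S t ↔ x ∈ S t)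
    {s n : ℕ} (hsn : s ≤ n)
    (hfix : ∀ k l, s ≤ k → k ≤ l → l ≤ n → fixingSubgroup A (S l) ≤ fixingSubgroup A (S k))
    (hbot : fixingSubgroup A (S n) = ⊥) {β : ℕ} (hβ : 5 ≤ β)
    (hm : 3 * ((S n).ncard - 1) < 2 ^ β) (T : Finset ℕ) (hT : T ⊆ Finset.Icc s n)
    (hTc : 3 * ((S n).ncard - 1) < 2 * T.card) :
    ∃ Y : ℕ → Finset X, (∀ t, (Y t : Set X) ⊆ S t) ∧
      2 ^ (∑ t ∈ T, (Y t).card) ≤ ((S n).ncard.factorial) ^ β ∧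
      ∃ t ∈ T, ∀ a : A, (∀ u ∈ T, ∀ x, a • x ∈ Y u ↔ x ∈ Y u) → ∀ x ∈ S t, a • x = x := by
  classical
  let f : A →* Equiv.Perm {x // x ∈ S n} := restrHom (· ∈ S n) (hS n)
  have hf : Function.Injective f := by
    refine (injective_iff_map_eq_one _).2 fun a ha => ?_
    have h1 := (mem_ker_restrHom _ _ a).1 (MonoidHom.mem_ker.2 ha)
    rw [← Subgroup.mem_bot, ← hbot, mem_fixingSubgroup_iff]
    exact h1
  let : MulAction A {x // x ∈ S n} := MulAction.compHom _ f
  have hfaith : FaithfulSMul A {x // x ∈ S n} := by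
    refine ⟨fun {a b} h => hf (Equiv.ext h)⟩
  let L : ℕ → Subgroup A := fun j => if j ≤ n - s then fixingSubgroup A (S (n - j)) else ⊤
  have hLm : Monotone L := by
    intro i j hij
    by_cases hj : j ≤ n - s
    · simp only [L, if_pos hj, if_pos (hij.trans hj)]
      exact hfix _ _ (by omega) (by omega) (by omega)
    · simp only [L, if_neg hj]
      exact le_top
  have hLn : ∀ i, (L i).Normal := by
    intro i
    simp only [L]
    split_ifs
    · exact normal_fixingSubgroup _ (hS _)
    · infer_instance
  obtain ⟨c, hc, hcs⟩ := exists_chain_costs (A := A) (Ω := {x // x ∈ S n}) hβ hm L hLm hLn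
    (n - s + 1)
  obtain ⟨Y, hY, hcard, t, ht, hfixt⟩ := exists_sets_of_chain (β := β) (by omega) L hLn hLm
    (r := n - s + 1) (by simp [L]) S hS T ⊤ c (fun t ht => ⟨n - t, by
      have := Finset.mem_Icc.1 (hT ht)
      have h1 : n - t ≤ n - s := by omega
      have h2 : n - (n - t) = t := by omega
      simp only [L, if_pos h1, h2]⟩) (fun j _ => by simpa using hc j) (by
      have : 2 * ∑ j ∈ Finset.range (n - s + 1), c j ≤ 3 * ((S n).ncard - 1) := hcs
      omega)
  refine ⟨Y, hY, hcard.trans ?_, t, ht, fun a ha => hfixt a (Subgroup.mem_top a) ha⟩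
  refine Nat.pow_le_pow_left ?_ _
  rw [Subgroup.card_top]
  have := Fintype.ofFinite {x // x ∈ S n}
  calc Nat.card A ≤ Nat.card (Equiv.Perm {x // x ∈ S n}) := Nat.card_le_card_of_injective f hf
    _ = (S n).ncard.factorial := by
      rw [Nat.card_perm]; rfl

theorem exists_breaking_sets.{u} {Γ V : Type u} [Group Γ] [MulAction Γ V] (S : ℕ → Set V)
    (hSf : ∀ t, (S t).Finite) {s n : ℕ} (hsn : s ≤ n)
    (hS : ∀ t, s ≤ t → ∀ (a : Γ) x, a • x ∈ S t ↔ x ∈ S t)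
    (hfix : ∀ k l, s ≤ k → k ≤ l → l ≤ n → fixingSubgroup Γ (S l) ≤ fixingSubgroup Γ (S k))
    {β : ℕ} (hβ : 5 ≤ β)
    (hm : 3 * ((S n).ncard - 1) < 2 ^ β) (T : Finset ℕ) (hT : T ⊆ Finset.Icc s n)
    (hTc : 3 * ((S n).ncard - 1) < 2 * T.card) :
    ∃ Y : ℕ → Finset V, (∀ t, (Y t : Set V) ⊆ S t) ∧
      2 ^ (∑ t ∈ T, (Y t).card) ≤ ((S n).ncard.factorial) ^ β ∧
      ∃ t ∈ T, ∀ a : Γ, (∀ u ∈ T, ∀ x, a • x ∈ Y u ↔ x ∈ Y u) → ∀ x ∈ S t, a • x = x := by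
  classical
  let P : V → Prop := fun x => ∃ k ∈ Finset.Icc s n, x ∈ S k
  have hPf : {x | P x}.Finite := by
    have : {x | P x} = ⋃ k ∈ Finset.Icc s n, S k := by ext; simp [P]
    rw [this]
    exact Set.Finite.biUnion (Finset.finite_toSet _) fun k _ => hSf k
  have : Finite {x // P x} := hPf.to_subtype
  have hP : ∀ (a : Γ) x, P (a • x) ↔ P x := by
    intro a x
    refine exists_congr fun k => and_congr_right fun hk => ?_
    exact hS k (Finset.mem_Icc.1 hk).1 a x
  let f : Γ →* Equiv.Perm {x // P x} := restrHom P hP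
  have hmem : ∀ k, s ≤ k → k ≤ n → ∀ x ∈ S k, P x :=
    fun k h1 h2 x hx => ⟨k, Finset.mem_Icc.2 ⟨h1, h2⟩, hx⟩
  let S' : ℕ → Set {x // P x} := fun k => {x | s ≤ k ∧ (x : V) ∈ S k}
  have hmemS' : ∀ k, s ≤ k → ∀ x : {x // P x}, x ∈ S' k ↔ (x : V) ∈ S k :=
    fun k hk x => ⟨fun h => h.2, fun h => ⟨hk, h⟩⟩
  have himg : ∀ a : f.range, ∃ g : Γ, ∀ x : {x // P x},
      ((a • x : {x // P x}) : V) = g • (x : V) := by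
    rintro ⟨a, g, rfl⟩
    exact ⟨g, fun x => restrHom_apply_coe P hP g x⟩
  have hfix_iff : ∀ (a : f.range) (g : Γ),
      (∀ x : {x // P x}, ((a • x : {x // P x}) : V) = g • (x : V)) → ∀ k, s ≤ k → k ≤ n →
      (a ∈ fixingSubgroup f.range (S' k) ↔ g ∈ fixingSubgroup Γ (S k)) := by
    intro a g hag k hk hkn
    rw [mem_fixingSubgroup_iff, mem_fixingSubgroup_iff]
    constructor
    · intro h x hx
      rw [← hag ⟨x, hmem k hk hkn x hx⟩, h _ ((hmemS' k hk _).2 hx)]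
    · intro h x hx
      apply Subtype.ext
      rw [hag, h _ ((hmemS' k hk _).1 hx)]
  have hncard : (S' n).ncard = (S n).ncard := by
    rw [← Set.ncard_image_of_injective _ Subtype.val_injective]
    congr 1
    ext x
    constructor
    · rintro ⟨y, hy, rfl⟩
      exact hy.2
    · exact fun hx => ⟨⟨x, hmem n hsn le_rfl x hx⟩, ⟨hsn, hx⟩, rfl⟩
  obtain ⟨Y, hY, hcard, t, ht, hfixt⟩ := exists_breaking_sets_of_finite (A := f.range) S' (by
      intro t a x
      obtain ⟨g, hg⟩ := himg a
      refine and_congr_right fun hst => ?_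
      rw [hg]
      exact hS t hst g x) hsn (by
      intro k l hk hkl hl a ha
      obtain ⟨g, hg⟩ := himg a
      rw [hfix_iff a g hg k hk (hkl.trans hl)]
      rw [hfix_iff a g hg l (hk.trans hkl) hl] at ha
      exact hfix k l hk hkl hl ha) (by
      rw [eq_bot_iff]
      intro a ha
      obtain ⟨g, hg⟩ := himg a
      rw [hfix_iff a g hg n hsn le_rfl] at ha
      rw [Subgroup.mem_bot]
      refine FaithfulSMul.eq_of_smul_eq_smul (α := {x // P x}) fun x => ?_
      rw [one_smul]
      apply Subtype.ext
      rw [hg]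
      obtain ⟨k, hk, hx⟩ := x.2
      rw [Finset.mem_Icc] at hk
      exact (mem_fixingSubgroup_iff _).1 (hfix k n hk.1 hk.2 le_rfl ha) _ hx)
      hβ (by rwa [hncard]) T hT (by rwa [hncard])
  refine ⟨fun t => (Y t).map (Function.Embedding.subtype _), fun t x hx => ?_, ?_, t, ht, ?_⟩
  · obtain ⟨y, hy, rfl⟩ := Finset.mem_map.1 (Finset.mem_coe.1 hx)
    exact (hY t hy).2
  · simpa [hncard] using hcard
  · intro a ha x hx
    have hst := Finset.mem_Icc.1 (hT ht)
    have := hfixt ⟨f a, a, rfl⟩ (fun u hu y => by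
      have := ha u hu y
      have h2 : ∀ z : {x // P x}, (z : V) ∈ (Y u).map (Function.Embedding.subtype _) ↔ z ∈ Y u := by
        intro z
        simp [z.2]
      rw [← h2, ← h2]
      exact this) ⟨x, hmem t hst.1 hst.2 x hx⟩ ((hmemS' t hst.1 _).2 hx)
    exact congrArg Subtype.val this

section GraphMetric

variable {V : Type*} {G : SimpleGraph V}

theorem dist_map_iso (hconn : G.Connected) (g : G ≃g G) (x y : V) :
    G.dist (g x) (g y) = G.dist x y := by
  have key : ∀ (f : G ≃g G) (a b : V), G.dist (f a) (f b) ≤ G.dist a b := fun f a b => by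
    obtain ⟨p, hp⟩ := hconn.exists_walk_length_eq_dist a b
    have h := dist_le (p.map f.toHom)
    rwa [Walk.length_map, hp] at h
  refine le_antisymm (key g x y) ?_
  simpa using key g.symm (g x) (g y)

theorem exists_dist_eq_and_dist_eq_sub (hconn : G.Connected) (v x : V) {j : ℕ}
    (hj : j ≤ G.dist v x) : ∃ y, G.dist v y = j ∧ G.dist y x = G.dist v x - j := by
  obtain ⟨p, hp⟩ := hconn.exists_walk_length_eq_dist v x
  have h1 := dist_le (p.take j)
  have h2 := dist_le (p.drop j)
  have h3 := hconn.dist_triangle (u := v) (v := p.getVert j) (w := x)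
  rw [Walk.take_length] at h1
  rw [Walk.drop_length] at h2
  refine ⟨p.getVert j, ?_, ?_⟩ <;> omega

theorem finite_gball (hconn : G.Connected) (hlf : ∀ x : V, (G.neighborSet x).Finite) (v : V)
    (n : ℕ) : (gball G v n).Finite := by
  induction n with
  | zero =>
    refine (Set.finite_singleton v).subset fun x hx => ?_
    have : G.dist v x = 0 := Nat.le_zero.1 hx
    exact (hconn.dist_eq_zero_iff.1 this).symm
  | succ n ih =>
    refine (ih.union (ih.biUnion fun y _ => hlf y)).subset fun x hx => ?_
    have hx' : G.dist v x ≤ n + 1 := hx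
    rcases Nat.lt_or_ge n (G.dist v x) with h | h
    · obtain ⟨y, hy, hyx⟩ := exists_dist_eq_and_dist_eq_sub hconn v x (Nat.le_of_lt h)
      refine Or.inr (Set.mem_biUnion (x := y) (show G.dist v y ≤ n from hy.le) ?_)
      exact dist_eq_one_iff_adj.1 (by omega)
    · exact Or.inl h

theorem gsphere_subset_gball (v : V) (n : ℕ) : gsphere G v n ⊆ gball G v n :=
  fun _ hx => le_of_eq hx

theorem finite_gsphere (hconn : G.Connected) (hlf : ∀ x : V, (G.neighborSet x).Finite) (v : V)
    (n : ℕ) : (gsphere G v n).Finite :=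
  (finite_gball hconn hlf v n).subset (gsphere_subset_gball v n)

theorem gsphere_nonempty [Infinite V] (hconn : G.Connected)
    (hlf : ∀ x : V, (G.neighborSet x).Finite) (v : V) (n : ℕ) : (gsphere G v n).Nonempty := by
  obtain ⟨x, hx⟩ := (finite_gball hconn hlf v n).exists_notMem
  obtain ⟨y, hy, -⟩ := exists_dist_eq_and_dist_eq_sub hconn v x (Nat.le_of_lt (not_le.1 hx))
  exact ⟨y, hy⟩

theorem sum_ncard_gsphere (hconn : G.Connected) (hlf : ∀ x : V, (G.neighborSet x).Finite) (v : V)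
    (n : ℕ) : ∑ j ∈ Finset.range (n + 1), (gsphere G v j).ncard = (gball G v n).ncard := by
  induction n with
  | zero =>
    have : gsphere G v 0 = gball G v 0 := Set.ext fun x => (Nat.le_zero (i := G.dist v x)).symm
    simp [this]
  | succ n ih =>
    rw [Finset.sum_range_succ, ih, ← Set.ncard_union_eq _ (finite_gball hconn hlf v n)
      (finite_gsphere hconn hlf v (n + 1))]
    · congr 1
      ext x
      exact (Nat.le_succ_iff (m := G.dist v x)).symm
    · refine Set.disjoint_left.2 fun x hx hx' => ?_
      have h1 : G.dist v x ≤ n := hx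
      have h2 : G.dist v x = n + 1 := hx'
      omega

/-- An automorphism fixing a sphere pointwise and preserving the ball it bounds fixes that ball
pointwise, provided every nontrivial automorphism moves infinitely many vertices. -/
theorem fix_gball_of_fix_gsphere (hconn : G.Connected) (hlf : ∀ x : V, (G.neighborSet x).Finite)
    (hmot : InfiniteMotion G) {v : V} {k : ℕ} (g : G ≃g G)
    (hb : ∀ x, G.dist v (g x) ≤ k ↔ G.dist v x ≤ k) (hs : ∀ x, G.dist v x = k → g x = x) :
    ∀ x, G.dist v x ≤ k → g x = x := by
  classical
  have hb' : ∀ x, G.dist v (g.symm x) ≤ k ↔ G.dist v x ≤ k := fun x => by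
    rw [← hb (g.symm x), g.apply_symm_apply]
  let e : V ≃ V :=
    { toFun := fun x => if G.dist v x ≤ k then g x else x
      invFun := fun x => if G.dist v x ≤ k then g.symm x else x
      left_inv := fun x => by
        by_cases h : G.dist v x ≤ k
        · simp [h, hb]
        · simp [h]
      right_inv := fun x => by
        by_cases h : G.dist v x ≤ k
        · simp [h, hb']
        · simp [h] }
  have hcross : ∀ x y, G.dist v x ≤ k → ¬ G.dist v y ≤ k → (G.Adj (g x) y ↔ G.Adj x y) := by
    intro x y hx hy
    have hgx := (hb x).2 hx
    constructor
    · intro h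
      have h1 := hconn.dist_triangle (u := v) (v := g x) (w := y)
      rw [dist_eq_one_iff_adj.2 h] at h1
      have h2 := hs (g x) (by omega)
      rw [g.injective h2] at h
      exact h
    · intro h
      have h1 := hconn.dist_triangle (u := v) (v := x) (w := y)
      rw [dist_eq_one_iff_adj.2 h] at h1
      rwa [hs x (by omega)]
  let f : G ≃g G :=
    { e with
      map_rel_iff' := fun {x y} => by
        change G.Adj (if G.dist v x ≤ k then g x else x) (if G.dist v y ≤ k then g y else y) ↔ _
        by_cases hx : G.dist v x ≤ k <;> by_cases hy : G.dist v y ≤ k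
        · simpa only [hx, hy, if_true] using g.map_rel_iff
        · simp [hx, hy, hcross x y]
        · simp only [hx, hy, if_true, if_false]
          rw [G.adj_comm, hcross y x hy hx, G.adj_comm]
        · simp [hx, hy] }
  have hf : ∀ x, f x = if G.dist v x ≤ k then g x else x := fun _ => rfl
  by_contra! hne
  obtain ⟨x, hx, hgx⟩ := hne
  refine hmot f ⟨x, by rwa [hf, if_pos hx]⟩ ((finite_gball hconn hlf v k).subset fun y hy => ?_)
  by_contra hyk
  exact hy (by rw [hf, if_neg (show ¬ G.dist v y ≤ k from hyk)])

end GraphMetric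

theorem factorial_le_two_pow_log_mul (m : ℕ) :
    m.factorial ≤ 2 ^ ((Nat.log 2 m + 1) * m) := by
  refine (Nat.factorial_le_pow m).trans ?_
  rw [pow_mul]
  exact Nat.pow_le_pow_left (Nat.lt_pow_succ_log_self (by norm_num) m).le m

theorem three_mul_sub_one_lt_two_pow_log_add (m : ℕ) :
    3 * (m - 1) < 2 ^ (Nat.log 2 m + 8) := by
  have := Nat.lt_pow_succ_log_self (b := 2) (by norm_num) m
  rw [pow_add]
  rw [pow_succ] at this
  omega

/-- Powers of the logarithm are eventually dominated by linear functions. -/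
theorem eventually_mul_log_add_pow_le (C : ℕ) :
    ∃ n₀, ∀ n ≥ n₀, C * (Nat.log 2 n + 8) ^ 4 ≤ n := by
  have h : ∀ᶠ t : ℕ in atTop, C * (t + 8) ^ 4 ≤ 2 ^ t := by
    have h1 : Tendsto (fun n : ℕ => (n : ℝ) ^ 4 / (2 : ℝ) ^ n) atTop (nhds 0) :=
      tendsto_pow_const_div_const_pow_of_one_lt 4 (by norm_num)
    have h2 := (tendsto_add_atTop_iff_nat 8).2 h1
    have h3 : (0 : ℝ) < 1 / ((C + 1) * 256) := by positivity
    filter_upwards [h2.eventually_lt_const h3] with t ht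
    rw [div_lt_div_iff₀ (by positivity) (by positivity)] at ht
    rw [pow_add] at ht
    have h4 : ((t + 8 : ℕ) : ℝ) ^ 4 * (C + 1) ≤ 2 ^ t := by nlinarith
    have h5 : (t + 8) ^ 4 * (C + 1) ≤ 2 ^ t := by exact_mod_cast h4
    nlinarith [Nat.zero_le ((t + 8) ^ 4)]
  obtain ⟨t₀, ht₀⟩ := eventually_atTop.1 h
  refine ⟨2 ^ t₀, fun n hn => ?_⟩
  have hn0 : n ≠ 0 := by
    have := Nat.two_pow_pos t₀
    omega
  exact (ht₀ _ (Nat.le_log_of_pow_le (by norm_num) hn)).trans (Nat.pow_log_le_self 2 hn0)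

theorem log_add_mono {a n : ℕ} (h : a ≤ n) : Nat.log 2 a + 8 ≤ Nat.log 2 n + 8 :=
  Nat.add_le_add_right (Nat.log_mono_right h) 8

/-- Under a linear growth bound along infinitely many indices, one of these indices `n` has
`a n` small in comparison with the sum of the earlier terms. -/
theorem exists_ge_mul_log_sq_le_sum (a : ℕ → ℕ) (ha : ∀ k, 1 ≤ a k) {q : ℕ} (hq : 2 ≤ q)
    (hinf : {n | 3 * q * a n ≤ 2 * n * (q - 1)}.Infinite) (N K P : ℕ) :
    ∃ n ≥ N, 3 * q * a n ≤ 2 * n * (q - 1) ∧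
      K * (P + (Nat.log 2 (a n) + 8) ^ 2 * a n) ≤ ∑ j ∈ Finset.range (n / (4 * q) + 1), a j := by
  have hale : ∀ n, 3 * q * a n ≤ 2 * n * (q - 1) → a n ≤ n := fun n hn => by
    obtain ⟨p, rfl⟩ : ∃ p, q = p + 1 := ⟨q - 1, by omega⟩
    rw [Nat.add_sub_cancel] at hn
    by_contra hlt
    nlinarith
  set C₁ := K * (P + 16 * q) with hC₁
  obtain ⟨n₀, hn₀⟩ := eventually_mul_log_add_pow_le
    (12 * q ^ 2 * C₁ + 32 * q ^ 2 * (K * (P + C₁)))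
  obtain ⟨n, hn, hnN⟩ := hinf.exists_gt (n₀ + 8 * q * N + N + 4 * q)
  have hn' : 3 * q * a n ≤ 2 * n * (q - 1) := hn
  by_cases hgood : K * (P + (Nat.log 2 (a n) + 8) ^ 2 * a n) ≤
      ∑ j ∈ Finset.range (n / (4 * q) + 1), a j
  · exact ⟨n, by nlinarith, hn', hgood⟩
  have hlog := hn₀ n (by nlinarith)
  set L := Nat.log 2 n + 8 with hL
  have hL1 : 1 ≤ L := by omega
  have hL2 : 1 ≤ L ^ 2 := Nat.one_le_pow _ _ hL1
  have hL4 : L ^ 2 ≤ L ^ 4 := Nat.pow_le_pow_right hL1 (by norm_num)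
  set h := n / (4 * q) with hh
  have hh1 : 1 ≤ h := (Nat.one_le_div_iff (by omega)).2 (by nlinarith)
  have hnh : n < 4 * q * (h + 1) := Nat.lt_mul_div_succ n (by omega)
  have hsum : ∑ j ∈ Finset.range (h + 1), a j < K * (P + L ^ 2 * n) := by
    refine (not_le.1 hgood).trans_le (Nat.mul_le_mul_left K (Nat.add_le_add_left ?_ P))
    exact Nat.mul_le_mul (Nat.pow_le_pow_left (log_add_mono (hale n hn')) 2) (hale n hn')
  obtain ⟨j, hj, hjle⟩ : ∃ j ∈ Finset.Ioc (h / 2) h,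
      a j * (h - h / 2) ≤ ∑ j ∈ Finset.range (h + 1), a j := by
    obtain ⟨j, hj, hmin⟩ := Finset.exists_min_image (Finset.Ioc (h / 2) h) a
      ⟨h, by rw [Finset.mem_Ioc]; omega⟩
    refine ⟨j, hj, ?_⟩
    calc a j * (h - h / 2) = ∑ _i ∈ Finset.Ioc (h / 2) h, a j := by
          rw [Finset.sum_const, Nat.card_Ioc, smul_eq_mul, mul_comm]
      _ ≤ ∑ i ∈ Finset.Ioc (h / 2) h, a i := Finset.sum_le_sum hmin
      _ ≤ _ := Finset.sum_le_sum_of_subset fun i hi => by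
          rw [Finset.mem_Ioc] at hi
          rw [Finset.mem_range]
          omega
  rw [Finset.mem_Ioc] at hj
  have haj : a j ≤ C₁ * L ^ 2 := by
    have hw : 1 ≤ h - h / 2 := by omega
    have hw2 : h + 1 ≤ 4 * (h - h / 2) := by omega
    set w := h - h / 2
    have hnw : n ≤ 16 * q * w := by nlinarith
    have h1 : a j * w ≤ C₁ * L ^ 2 * w := by
      calc a j * w ≤ K * (P + L ^ 2 * n) := (hjle.trans_lt hsum).le
        _ ≤ K * (P * L ^ 2 * w + L ^ 2 * (16 * q * w)) := by
            refine Nat.mul_le_mul_left K (add_le_add ?_ (Nat.mul_le_mul_left _ hnw))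
            rw [mul_assoc]
            exact Nat.le_mul_of_pos_right P (Nat.mul_pos hL2 hw)
        _ = C₁ * L ^ 2 * w := by rw [hC₁]; ring
    exact Nat.le_of_mul_le_mul_right h1 hw
  have hnj : n ≤ 8 * q * j := by
    have : h + 1 ≤ 2 * j := by omega
    nlinarith
  have hgrow : 3 * q * a j ≤ 2 * j * (q - 1) := by
    have h1 : 3 * q * (C₁ * L ^ 2) ≤ 2 * j := by
      have h2 : 12 * q ^ 2 * C₁ * L ^ 2 ≤ n := by
        refine le_trans ?_ hlog
        exact Nat.mul_le_mul (Nat.le_add_right _ _) hL4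
      have h3 : q * (12 * q * C₁ * L ^ 2) ≤ q * (8 * j) := by
        calc q * (12 * q * C₁ * L ^ 2) = 12 * q ^ 2 * C₁ * L ^ 2 := by ring
          _ ≤ n := h2
          _ ≤ 8 * q * j := hnj
          _ = q * (8 * j) := by ring
      have h4 := Nat.le_of_mul_le_mul_left h3 (by omega)
      nlinarith
    calc 3 * q * a j ≤ 3 * q * (C₁ * L ^ 2) := Nat.mul_le_mul_left _ haj
      _ ≤ 2 * j := h1
      _ ≤ 2 * j * (q - 1) := Nat.le_mul_of_pos_right _ (by omega)
  have hjn : j ≤ n := hj.2.trans (Nat.div_le_self _ _)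
  refine ⟨j, ?_, hgrow, ?_⟩
  · have h1 : 8 * q * N ≤ 8 * q * j := le_trans (by omega) hnj
    exact Nat.le_of_mul_le_mul_left h1 (by omega)
  · have h1 : K * (P + (Nat.log 2 (a j) + 8) ^ 2 * a j) ≤ K * (P + C₁) * L ^ 4 := by
      calc K * (P + (Nat.log 2 (a j) + 8) ^ 2 * a j) ≤ K * (P * L ^ 4 + L ^ 2 * (C₁ * L ^ 2)) := by
            refine Nat.mul_le_mul_left K (add_le_add ?_ (Nat.mul_le_mul ?_ haj))
            · exact Nat.le_mul_of_pos_right P (by omega)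
            · exact Nat.pow_le_pow_left (log_add_mono ((hale j hgrow).trans hjn)) 2
        _ = K * (P + C₁) * L ^ 4 := by ring
    have h2 : 32 * q ^ 2 * (K * (P + C₁) * L ^ 4) ≤ n := by
      refine le_trans ?_ hlog
      rw [← mul_assoc, ← mul_assoc]
      refine Nat.mul_le_mul_right _ ?_
      rw [mul_assoc (32 * q ^ 2)]
      exact Nat.le_add_left _ _
    have h3 : j < 4 * q * (j / (4 * q) + 1) := Nat.lt_mul_div_succ j (by omega)
    have h4 : j / (4 * q) + 1 ≤ ∑ i ∈ Finset.range (j / (4 * q) + 1), a i := by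
      simpa using Finset.card_nsmul_le_sum (Finset.range (j / (4 * q) + 1)) a 1 fun i _ => ha i
    refine h1.trans (le_trans ?_ h4)
    have h5 : 32 * q ^ 2 * (K * (P + C₁) * L ^ 4) ≤ 32 * q ^ 2 * (j / (4 * q) + 1) := by
      refine h2.trans (hnj.trans ?_)
      calc 8 * q * j ≤ 8 * q * (4 * q * (j / (4 * q) + 1)) := Nat.mul_le_mul_left _ h3.le
        _ = _ := by ring
    exact Nat.le_of_mul_le_mul_left h5 (by positivity)

theorem mul_card_filter_dvd_Icc_le {s n d : ℕ} (hd : 0 < d) (hsn : s ≤ n) :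
    d * ((Finset.Icc s n).filter (d ∣ ·)).card ≤ n - s + d := by
  have h1 : ((Finset.Icc s n).filter (d ∣ ·)).card ≤
      (Finset.Icc ((s + d - 1) / d) (n / d)).card := by
    refine Finset.card_le_card_of_injOn (· / d) (fun x hx => ?_) fun x hx y hy hxy => ?_
    · simp only [Finset.coe_filter, Finset.mem_Icc, Set.mem_ofPred_eq] at hx
      obtain ⟨⟨h1, h2⟩, c, rfl⟩ := hx
      simp only [Finset.coe_Icc, Set.mem_Icc, Nat.mul_div_cancel_left _ hd]
      refine ⟨?_, (Nat.le_div_iff_mul_le hd).2 (by rwa [mul_comm])⟩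
      have : (s + d - 1) / d < c + 1 := (Nat.div_lt_iff_lt_mul hd).2 (by
        nlinarith [Nat.sub_lt (show 0 < s + d by omega) one_pos])
      omega
    · simp only [Finset.coe_filter, Finset.mem_Icc, Set.mem_ofPred_eq] at hx hy
      exact (Nat.div_left_inj hx.2 hy.2).1 hxy
  refine (Nat.mul_le_mul_left d h1).trans ?_
  rw [Nat.card_Icc, Nat.mul_sub, mul_add, mul_one]
  have h2 := Nat.mul_div_le n d
  have h3 := Nat.lt_mul_div_succ (s + d - 1) hd
  rw [mul_add] at h3
  omega

theorem le_mul_card_filter_not_dvd_Icc (n : ℕ) {q : ℕ} (hq : 2 ≤ q) :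
    2 * n * (q - 1) ≤ q * (2 * ((Finset.Icc (n / (2 * q)) n).filter (¬ 4 * q ∣ ·)).card) := by
  have hsn : n / (2 * q) ≤ n := Nat.div_le_self _ _
  have h1 := mul_card_filter_dvd_Icc_le (d := 4 * q) (by omega) hsn
  have h2 := Finset.card_filter_add_card_filter_not (s := Finset.Icc (n / (2 * q)) n) (4 * q ∣ ·)
  have h3 := Nat.mul_div_le n (2 * q)
  rw [Nat.card_Icc] at h2
  generalize n / (2 * q) = s at *
  obtain ⟨p, rfl⟩ : ∃ p, q = p + 1 := ⟨q - 1, by omega⟩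
  rw [Nat.add_sub_cancel]
  obtain ⟨w, rfl⟩ : ∃ w, n = s + w := ⟨n - s, by omega⟩
  rw [Nat.add_sub_cancel_left] at h1
  have h4 : ((Finset.Icc s (s + w)).filter (4 * (p + 1) ∣ ·)).card +
      ((Finset.Icc s (s + w)).filter (¬ 4 * (p + 1) ∣ ·)).card = w + 1 := by omega
  have h5 := congrArg (2 * (p + 1) * ·) h4
  nlinarith

/-- The automorphisms preserving all balls around `v` of radius at least `r`. -/
def ballPreserving {V : Type*} (G : SimpleGraph V) (v : V) (r : ℕ) : Subgroup (G ≃g G) where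
  carrier := {g | ∀ k, r ≤ k → ∀ x, G.dist v (g x) ≤ k ↔ G.dist v x ≤ k}
  one_mem' := fun _ _ _ => Iff.rfl
  mul_mem' := fun {g h} hg hh k hk x => (hg k hk (h x)).trans (hh k hk x)
  inv_mem' := fun {g} hg k hk x => by
    have h := hg k hk (g⁻¹ x)
    rw [RelIso.apply_inv_self] at h
    exact h.symm

section GraphStage

variable {V : Type*} {G : SimpleGraph V}

theorem dist_map_of_mem_ballPreserving {v : V} {r : ℕ} {g : G ≃g G}
    (hg : g ∈ ballPreserving G v r) {k : ℕ} (hk : r < k) (x : V) :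
    G.dist v (g x) = k ↔ G.dist v x = k := by
  have h1 := hg k hk.le x
  have h2 := hg (k - 1) (by omega) x
  omega

/-- An automorphism preserving the ball of radius `r` around `v` preserves all larger balls. -/
theorem mem_ballPreserving_of_image_eq (hconn : G.Connected) {v : V} {r : ℕ} {g : G ≃g G}
    (hg : ∀ x, G.dist v (g x) ≤ r ↔ G.dist v x ≤ r) : g ∈ ballPreserving G v r := by
  have key : ∀ f : G ≃g G, (∀ x, G.dist v x ≤ r → G.dist v (f x) ≤ r) →
      ∀ k, r ≤ k → ∀ x, G.dist v x ≤ k → G.dist v (f x) ≤ k := by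
    intro f hf k hk x hx
    rcases le_total (G.dist v x) r with h | h
    · exact (hf x h).trans hk
    · obtain ⟨y, hy, hyx⟩ := exists_dist_eq_and_dist_eq_sub hconn v x h
      have h1 := hconn.dist_triangle (u := v) (v := f y) (w := f x)
      rw [dist_map_iso hconn] at h1
      have h2 := hf y hy.le
      omega
  intro k hk x
  refine ⟨fun h => ?_, key g (fun x => (hg x).2) k hk x⟩
  have h1 := key g.symm (fun x hx => by rwa [← hg, g.apply_symm_apply]) k hk (g x) h
  rwa [g.symm_apply_apply] at h1

/-- One can find few vertices far from `v`, at distances not divisible by `4 * q`, such that the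
ball-preserving automorphisms preserving this set of vertices all fix some sphere pointwise. -/
theorem exists_sphere_breaking_finset [Infinite V] (hconn : G.Connected)
    (hlf : ∀ x : V, (G.neighborSet x).Finite) (hmot : InfiniteMotion G) (v : V) {q : ℕ}
    (hq : 2 ≤ q)
    (hinf : {n | 3 * q * (gsphere G v n).ncard ≤ 2 * n * (q - 1)}.Infinite) (r i P N : ℕ) :
    ∃ (Z : Finset V) (s : ℕ), N ≤ s ∧ (∀ x ∈ Z, s ≤ G.dist v x ∧ ¬ 4 * q ∣ G.dist v x) ∧
      i * (P + Z.card) ≤ (gball G v (s / 2)).ncard ∧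
      ∀ g ∈ ballPreserving G v r, (∀ x, g x ∈ Z ↔ x ∈ Z) →
        ∃ k ≥ s, ∀ x, G.dist v x = k → g x = x := by
  classical
  have hpos : ∀ k, 1 ≤ (gsphere G v k).ncard := fun k =>
    (Set.ncard_pos (finite_gsphere hconn hlf v k)).2 (gsphere_nonempty hconn hlf v k)
  obtain ⟨n, hnN, hn, hsum⟩ := exists_ge_mul_log_sq_le_sum (fun k => (gsphere G v k).ncard) hpos hq
    hinf (2 * q * (N + r + 1)) i P
  have hT := le_mul_card_filter_not_dvd_Icc n hq
  rw [sum_ncard_gsphere hconn hlf, show 4 * q = 2 * q * 2 by ring, ← Nat.div_div_eq_div_mul] at hsum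
  have hs : N + r + 1 ≤ n / (2 * q) :=
    (Nat.le_div_iff_mul_le (by omega)).2 (by rwa [mul_comm])
  have hsn : n / (2 * q) ≤ n := Nat.div_le_self _ _
  generalize n / (2 * q) = s at *
  set a := (gsphere G v n).ncard with ha
  have ha1 : 1 ≤ a := hpos n
  set T := (Finset.Icc s n).filter (¬ 4 * q ∣ ·) with hTdef
  have hTc : 3 * a ≤ 2 * T.card := by
    have h : q * (3 * a) ≤ q * (2 * T.card) := by
      refine le_trans (le_of_eq ?_) (hn.trans hT)
      ring
    exact Nat.le_of_mul_le_mul_left h (by omega)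
  obtain ⟨Y, hY, hYsum, t, ht, hfix⟩ := exists_breaking_sets (Γ := ballPreserving G v r)
    (fun k => gsphere G v k) (finite_gsphere hconn hlf v) hsn
    (fun k hk g x => dist_map_of_mem_ballPreserving g.2 (by omega) x)
    (fun k l hk hkl hl g hg => by
      rw [mem_fixingSubgroup_iff] at hg ⊢
      intro y hy
      have hy' : G.dist v y = k := hy
      exact fix_gball_of_fix_gsphere hconn hlf hmot (k := l) g.1 (g.2 l (by omega))
        (fun x hx => hg x hx) y (by omega))
    (β := Nat.log 2 a + 8) (by omega) (three_mul_sub_one_lt_two_pow_log_add a) T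
    (Finset.filter_subset _ _) (by omega)
  have hYdist : ∀ u x, x ∈ Y u → G.dist v x = u := fun u x hx => hY u hx
  have hTmem : ∀ u ∈ T, s ≤ u ∧ ¬ 4 * q ∣ u := fun u hu => by
    rw [hTdef, Finset.mem_filter, Finset.mem_Icc] at hu
    exact ⟨hu.1.1, hu.2⟩
  refine ⟨T.biUnion Y, s, by omega, fun x hx => ?_, ?_, fun g hg hgZ => ?_⟩
  · obtain ⟨u, hu, hxu⟩ := Finset.mem_biUnion.1 hx
    rw [hYdist u x hxu]
    exact hTmem u hu
  · refine le_trans (Nat.mul_le_mul_left i (Nat.add_le_add_left ?_ P)) hsum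
    refine Finset.card_biUnion_le.trans ?_
    have h1 : 2 ^ ∑ u ∈ T, (Y u).card ≤ 2 ^ ((Nat.log 2 a + 1) * a * (Nat.log 2 a + 8)) := by
      rw [pow_mul 2 ((Nat.log 2 a + 1) * a)]
      exact hYsum.trans (Nat.pow_le_pow_left (factorial_le_two_pow_log_mul a) _)
    refine ((Nat.pow_le_pow_iff_right (by norm_num)).1 h1).trans ?_
    nlinarith [Nat.zero_le (a * (Nat.log 2 a + 8))]
  · refine ⟨t, (hTmem t ht).1, fun x hx => hfix ⟨g, hg⟩ (fun u hu x => ?_) x hx⟩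
    have hmem : ∀ x, x ∈ Y u ↔ x ∈ T.biUnion Y ∧ G.dist v x = u := fun x => by
      refine ⟨fun h => ⟨Finset.mem_biUnion.2 ⟨u, hu, h⟩, hYdist u x h⟩, fun ⟨h, hxu⟩ => ?_⟩
      obtain ⟨w, -, hxw⟩ := Finset.mem_biUnion.1 h
      rwa [← hxu, hYdist w x hxw]
    change g x ∈ Y u ↔ x ∈ Y u
    rw [hmem, hmem, hgZ,
      dist_map_of_mem_ballPreserving hg (by have := (hTmem u hu).1; omega)]

end GraphStage

section GraphColoring

variable {V : Type*} {G : SimpleGraph V}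

/-- A layered set of vertices, containing the ball of radius `4 * q - 1` around `v`, whose layers
are sparse and break all ball-preserving automorphisms far out. -/
theorem exists_layered_set [Infinite V] (hconn : G.Connected)
    (hlf : ∀ x : V, (G.neighborSet x).Finite) (hmot : InfiniteMotion G) (v : V) {q : ℕ}
    (hq : 2 ≤ q)
    (hinf : {n | 3 * q * (gsphere G v n).ncard ≤ 2 * n * (q - 1)}.Infinite) (r : ℕ) :
    ∃ (W : Set V) (F : ℕ → Finset V) (s : ℕ → ℕ),
      (∀ i, i ≤ s i) ∧
      (∀ x ∈ W, G.dist v x ≤ r ∨ (2 * r < G.dist v x ∧ ¬ 4 * q ∣ G.dist v x)) ∧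
      (∀ x, G.dist v x ≤ r → x ∈ W) ∧
      (∀ i, ∀ x ∈ W, G.dist v x < s (i + 1) → x ∈ F (i + 1)) ∧
      (∀ i, i * (F (i + 1)).card ≤ (gball G v (s i / 2)).ncard) ∧
      ∀ i, ∀ g ∈ ballPreserving G v r, (∀ x, g x ∈ W ↔ x ∈ W) →
        ∃ k ≥ s i, ∀ x, G.dist v x = k → g x = x := by
  classical
  choose Z s hN hZ hcard hfix using
    exists_sphere_breaking_finset hconn hlf hmot v hq hinf r
  let st : ℕ → Finset V × ℕ := fun n => Nat.rec ((finite_gball hconn hlf v r).toFinset, 2 * r + 2)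
    (fun i p => (p.1 ∪ Z i p.1.card p.2,
      p.2 + s i p.1.card p.2 + (Z i p.1.card p.2).sup (G.dist v) + 1)) n
  let F : ℕ → Finset V := fun i => (st i).1
  let M : ℕ → ℕ := fun i => (st i).2
  let Y : ℕ → Finset V := fun i => Z i (F i).card (M i)
  let t : ℕ → ℕ := fun i => s i (F i).card (M i)
  have hF0 : F 0 = (finite_gball hconn hlf v r).toFinset := rfl
  have hM0 : M 0 = 2 * r + 2 := rfl
  have hF1 : ∀ i, F (i + 1) = F i ∪ Y i := fun _ => rfl
  have hM1 : ∀ i, M (i + 1) = M i + t i + (Y i).sup (G.dist v) + 1 := fun _ => rfl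
  have hMt : ∀ i, M i ≤ t i := fun i => hN _ _ _
  have hYt : ∀ i, ∀ x ∈ Y i, t i ≤ G.dist v x ∧ ¬ 4 * q ∣ G.dist v x := fun i => hZ _ _ _
  have hYM : ∀ i, ∀ x ∈ Y i, G.dist v x < M (i + 1) := fun i x hx => by
    have := Finset.le_sup (f := G.dist v) hx
    rw [hM1]
    omega
  have hMmono : Monotone M := monotone_nat_of_le_succ fun i => by
    rw [hM1]
    omega
  have hMr : ∀ i, 2 * r + 2 ≤ M i := fun i => hM0 ▸ hMmono (Nat.zero_le i)
  have hiM : ∀ i, i ≤ M i := fun i => by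
    induction i with
    | zero => exact Nat.zero_le _
    | succ i ih =>
      rw [hM1]
      omega
  have hFmono : Monotone F := monotone_nat_of_le_succ fun i => by
    rw [hF1]
    exact Finset.subset_union_left
  have hFM : ∀ i, ∀ x ∈ F i, G.dist v x < M i := fun i => by
    induction i with
    | zero =>
      intro x hx
      rw [hF0, Set.Finite.mem_toFinset] at hx
      have : G.dist v x ≤ r := hx
      omega
    | succ i ih =>
      intro x hx
      rw [hF1, Finset.mem_union] at hx
      rcases hx with hx | hx
      · exact (ih x hx).trans_le (hMmono (Nat.le_succ i))
      · exact hYM i x hx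
  have hlow : ∀ i j, ∀ x ∈ F j, x ∈ F i ∨ t i ≤ G.dist v x := fun i j => by
    induction j with
    | zero => exact fun x hx => Or.inl (hFmono (Nat.zero_le i) hx)
    | succ j ih =>
      intro x hx
      rcases Nat.lt_or_ge j i with hji | hji
      · exact Or.inl (hFmono hji hx)
      rw [hF1, Finset.mem_union] at hx
      rcases hx with hx | hx
      · exact ih x hx
      · refine Or.inr (le_trans ?_ (hYt j x hx).1)
        rcases hji.eq_or_lt with rfl | hlt
        · exact le_rfl
        · have h1 : M (i + 1) ≤ M j := hMmono hlt
          have h2 := hMt j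
          have h3 := hM1 i
          omega
  refine ⟨{x | ∃ i, x ∈ F i}, F, t, fun i => (hiM i).trans (hMt i), ?_,
    fun x hx => ⟨0, by rw [hF0, Set.Finite.mem_toFinset]; exact hx⟩, ?_, ?_, ?_⟩
  · rintro x ⟨i, hi⟩
    induction i with
    | zero =>
      rw [hF0, Set.Finite.mem_toFinset] at hi
      exact Or.inl hi
    | succ i ih =>
      rw [hF1, Finset.mem_union] at hi
      rcases hi with hi | hi
      · exact ih hi
      · have h1 := hMr i
        have h2 := hMt i
        have h3 := (hYt i x hi).1
        exact Or.inr ⟨by omega, (hYt i x hi).2⟩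
  · rintro i x ⟨j, hj⟩ hx
    exact (hlow (i + 1) j x hj).resolve_right (by omega)
  · intro i
    refine le_trans (Nat.mul_le_mul_left i ?_) (hcard i (F i).card (M i))
    rw [hF1]
    exact Finset.card_union_le _ _
  · intro i g hg hgW
    refine hfix i (F i).card (M i) g hg fun x => ?_
    have hmem : ∀ x, x ∈ Y i ↔ x ∈ {x | ∃ i, x ∈ F i} ∧ ¬ G.dist v x ≤ M i - 1 ∧
        G.dist v x ≤ M (i + 1) - 1 := fun x => by
      constructor
      · intro hx
        have h1 := hYM i x hx
        have h2 := (hYt i x hx).1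
        have h3 := hMt i
        have h4 := hMr i
        exact ⟨⟨i + 1, by rw [hF1]; exact Finset.mem_union_right _ hx⟩, by omega, by omega⟩
      · rintro ⟨⟨j, hj⟩, h1, h2⟩
        have h3 := hMr (i + 1)
        have h4 := hMt (i + 1)
        have h5 := (hlow (i + 1) j x hj).resolve_right (by omega)
        rw [hF1, Finset.mem_union] at h5
        exact h5.resolve_left fun h6 => h1 (by have := hFM i x h6; omega)
    have h1 := hMr i
    have h2 := hMr (i + 1)
    change g x ∈ Y i ↔ x ∈ Y i
    rw [hmem, hmem, hgW, hg _ (by omega), hg _ (by omega)]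

/-- A set covered up to large distances by sparse finite sets has density zero everywhere. -/
theorem densityZeroAt_of_layers (hconn : G.Connected)
    (hlf : ∀ x : V, (G.neighborSet x).Finite) {v : V} {W : Set V} {F : ℕ → Finset V} {s : ℕ → ℕ}
    (hs : ∀ i, i ≤ s i) (hF : ∀ i, ∀ x ∈ W, G.dist v x < s (i + 1) → x ∈ F (i + 1))
    (hcard : ∀ i, i * (F (i + 1)).card ≤ (gball G v (s i / 2)).ncard) (x : V) :
    DensityZeroAt G W x := by
  have hpos : ∀ k, 0 < (gball G x k).ncard := fun k =>
    (Set.ncard_pos (finite_gball hconn hlf x k)).2 ⟨x, show G.dist x x ≤ k by simp⟩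
  set D := G.dist v x with hD
  have key : ∀ K k, s K + 3 * D ≤ k →
      K * (gball G x k ∩ W).ncard ≤ (gball G x k).ncard := by
    intro K k hk
    obtain ⟨i, hKi, hi, hi'⟩ : ∃ i, K ≤ i ∧ s i ≤ k + D ∧ k + D < s (i + 1) := by
      by_contra! hcon
      have h : ∀ j, s (K + j) ≤ k + D := fun j => by
        induction j with
        | zero => rw [Nat.add_zero]; omega
        | succ j ih => exact hcon (K + j) (Nat.le_add_right _ _) ih
      have h1 := h (k + D + 1)
      have h2 := hs (K + (k + D + 1))
      omega
    have h1 : gball G x k ∩ W ⊆ F (i + 1) := fun y ⟨hy, hyW⟩ => by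
      have h2 := hconn.dist_triangle (u := v) (v := x) (w := y)
      have h3 : G.dist x y ≤ k := hy
      exact hF i y hyW (by omega)
    have h2 : gball G v (s i / 2) ⊆ gball G x k := fun y hy => by
      have h3 := hconn.dist_triangle (u := x) (v := v) (w := y)
      have h4 : G.dist v y ≤ s i / 2 := hy
      rw [G.dist_comm (u := x) (v := v)] at h3
      change G.dist x y ≤ k
      omega
    calc K * (gball G x k ∩ W).ncard ≤ i * (F (i + 1)).card :=
          Nat.mul_le_mul hKi (by
            rw [← Set.ncard_coe_finset]
            exact Set.ncard_le_ncard h1 (Finset.finite_toSet _))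
      _ ≤ (gball G v (s i / 2)).ncard := hcard i
      _ ≤ _ := Set.ncard_le_ncard h2 (finite_gball hconn hlf x k)
  refine Metric.tendsto_atTop.2 fun e he => ?_
  obtain ⟨K, hK⟩ := exists_nat_gt (1 / e)
  have hK0 : (0 : ℝ) < K := lt_trans (by positivity) hK
  refine ⟨s K + 3 * D, fun k hk => ?_⟩
  have h1 : (K : ℝ) * ((gball G x k ∩ W).ncard : ℝ) ≤ ((gball G x k).ncard : ℝ) := by
    exact_mod_cast key K k hk
  have h2 : (0 : ℝ) < ((gball G x k).ncard : ℝ) := by exact_mod_cast hpos k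
  rw [Real.dist_eq, sub_zero, abs_of_nonneg (by positivity), div_lt_iff₀ h2]
  rw [div_lt_iff₀ he] at hK
  rcases (Nat.cast_nonneg (α := ℝ) (gball G x k ∩ W).ncard).eq_or_lt with h3 | h3
  · rw [← h3]
    positivity
  · nlinarith

/-- If a set of vertices consists of the ball of radius `r` around `v` and vertices at distance
more than `2 * r` from `v` avoiding the multiples of `r + 1`, then the automorphisms preserving it
preserve all large balls around `v`. -/
theorem mem_ballPreserving_of_preserves (hconn : G.Connected)
    (hlf : ∀ x : V, (G.neighborSet x).Finite) {v : V} {r : ℕ} {W : Set V}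
    (hW : ∀ x ∈ W, G.dist v x ≤ r ∨ (2 * r < G.dist v x ∧ ¬ r + 1 ∣ G.dist v x))
    (hball : ∀ x, G.dist v x ≤ r → x ∈ W) {g : G ≃g G} (hg : ∀ x, g x ∈ W ↔ x ∈ W) :
    g ∈ ballPreserving G v r := by
  have himage : ∀ y, G.dist (g v) y ≤ r → y ∈ W := fun y hy => by
    rw [← g.apply_symm_apply y, dist_map_iso hconn] at hy
    have h := (hg _).2 (hball _ hy)
    rwa [g.apply_symm_apply] at h
  have hgv : G.dist v (g v) ≤ r := by
    by_contra! hlt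
    set k := G.dist v (g v) with hk
    have h1 := Nat.div_add_mod k (r + 1)
    have h2 := Nat.mod_lt k (show r + 1 > 0 by omega)
    obtain ⟨y, hy, hyg⟩ := exists_dist_eq_and_dist_eq_sub hconn v (g v)
      (j := (r + 1) * (k / (r + 1))) (Nat.mul_div_le k (r + 1))
    have h3 : 1 ≤ k / (r + 1) := (Nat.one_le_div_iff (Nat.succ_pos r)).2 hlt
    have h4 : r + 1 ≤ (r + 1) * (k / (r + 1)) := Nat.le_mul_of_pos_right _ h3
    have h5 := himage y (by rw [G.dist_comm]; omega)
    rcases hW y h5 with h6 | ⟨-, h6⟩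
    · omega
    · exact h6 ⟨_, hy⟩
  have hmaps : ∀ x, G.dist v x ≤ r → G.dist v (g x) ≤ r := fun x hx => by
    have h1 : G.dist (g v) (g x) ≤ r := by rwa [dist_map_iso hconn]
    have h2 := hconn.dist_triangle (u := v) (v := g v) (w := g x)
    rcases hW (g x) (himage _ h1) with h3 | ⟨h3, -⟩ <;> omega
  have himg : g '' gball G v r = gball G v r :=
    Set.eq_of_subset_of_ncard_le (Set.image_subset_iff.2 hmaps)
      (Set.ncard_image_of_injective _ g.injective).ge (finite_gball hconn hlf v r)
  refine mem_ballPreserving_of_image_eq hconn fun x => ⟨fun h => ?_, hmaps x⟩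
  have h1 : g x ∈ g '' gball G v r := by rw [himg]; exact h
  exact g.injective.mem_set_image.1 h1

end GraphColoring

/-- Let `G` be a connected, locally finite, infinite graph with
infinite motion. If there are `ε > 0` and a vertex `v` with `|S_v(n)| ≤ 2n(1-ε)/3`
for infinitely many `n`, then `G` admits a distinguishing 2-coloring one of whose
color classes has density zero at every vertex. -/
theorem stmt_15 {V : Type*} [Infinite V] (G : SimpleGraph V) (hconn : G.Connected)
    (hlf : ∀ x : V, (G.neighborSet x).Finite) (hmot : InfiniteMotion G)
    (ε : ℝ) (hε : 0 < ε) (v : V)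
    (hsmall : {n : ℕ | ((gsphere G v n).ncard : ℝ) ≤ 2 * n * (1 - ε) / 3}.Infinite) :
    ∃ l : V → Bool, Distinguishing G l ∧
      ∃ b : Bool, ∀ x : V, DensityZeroAt G {y | l y = b} x := by
  classical
  obtain ⟨p, hp⟩ := exists_nat_gt (1 / ε)
  set q := p + 2 with hqdef
  have hq : 2 ≤ q := by omega
  have hinf : {n | 3 * q * (gsphere G v n).ncard ≤ 2 * n * (q - 1)}.Infinite := by
    refine hsmall.mono fun n hn => ?_
    have hn' : ((gsphere G v n).ncard : ℝ) ≤ 2 * n * (1 - ε) / 3 := hn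
    rw [div_lt_iff₀ hε] at hp
    change 3 * q * (gsphere G v n).ncard ≤ 2 * n * (q - 1)
    have h1 : q - 1 = p + 1 := by omega
    rw [h1, hqdef]
    have h2 : (3 * (p + 2) * (gsphere G v n).ncard : ℝ) ≤ 2 * n * (p + 1) := by
      have h3 : ((p : ℝ) + 2) * (1 - ε) ≤ p + 1 := by nlinarith
      calc (3 * (p + 2) * (gsphere G v n).ncard : ℝ) ≤ 3 * (p + 2) * (2 * n * (1 - ε) / 3) := by
            gcongr
        _ = 2 * n * ((p + 2) * (1 - ε)) := by ring
        _ ≤ 2 * n * (p + 1) := by gcongr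
    exact_mod_cast h2
  obtain ⟨W, F, s, hs, hW, hball, hF, hcard, hfix⟩ :=
    exists_layered_set hconn hlf hmot v hq hinf (4 * q - 1)
  have hset : {y | decide (y ∈ W) = true} = W := Set.ext fun y => decide_eq_true_iff
  refine ⟨fun y => decide (y ∈ W), fun g hg x => ?_, true, fun x => ?_⟩
  · have hgW : ∀ y, g y ∈ W ↔ y ∈ W := fun y => decide_eq_decide.1 (hg y)
    have hgB : g ∈ ballPreserving G v (4 * q - 1) :=
      mem_ballPreserving_of_preserves hconn hlf
        (by rwa [show 4 * q - 1 + 1 = 4 * q by omega]) hball hgW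
    obtain ⟨k, hk, hgk⟩ := hfix (4 * q + G.dist v x) g hgB hgW
    have h1 := hs (4 * q + G.dist v x)
    exact fix_gball_of_fix_gsphere hconn hlf hmot g (hgB k (by omega)) hgk x (by omega)
  · rw [hset]
    exact densityZeroAt_of_layers hconn hlf hs hF hcard x
end

section
/- Let G be a connected, locally finite, infinite graph and v a vertex with lim_{n→∞} |B_v(n)|/n² = 0. Then for every ε with 0 < ε < 1 there are infinitely many n ∈ ℕ such that |S_v(n)| ≤ 2n(1−ε)/3. -/
open Filter SimpleGraph

theorem gball_succ {V : Type*} (G : SimpleGraph V) (v : V) (n : ℕ) :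
    gball G v (n + 1) = gball G v n ∪ gsphere G v (n + 1) := by
  ext x
  simp only [gball, gsphere, Set.mem_ofPred_eq, Set.mem_union]
  omega

theorem disjoint_gball_gsphere_succ {V : Type*} (G : SimpleGraph V) (v : V) (n : ℕ) :
    Disjoint (gball G v n) (gsphere G v (n + 1)) := by
  rw [Set.disjoint_left]
  intro x hx hx'
  simp only [gball, gsphere, Set.mem_ofPred_eq] at hx hx'
  omega

theorem gball_finite {V : Type*} {G : SimpleGraph V} (hconn : G.Connected)
    (hlf : ∀ x : V, (G.neighborSet x).Finite) (v : V) (n : ℕ) : (gball G v n).Finite := by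
  induction n with
  | zero =>
    refine (Set.finite_singleton v).subset fun x hx => ?_
    have hx : G.dist v x = 0 := Nat.le_zero.mp hx
    exact ((hconn.dist_eq_zero_iff).mp hx).symm
  | succ n ih =>
    refine (ih.union (ih.biUnion fun x _ => hlf x)).subset fun x hx => ?_
    rw [gball_succ] at hx
    refine hx.imp id fun hx => ?_
    have hx : G.dist x v = n + 1 := by rw [G.dist_comm]; exact hx
    obtain ⟨p, hp⟩ := hconn.exists_walk_length_eq_dist x v
    cases p with
    | nil => simp at hx
    | @cons _ y _ h q =>
      have hq : q.length = n := by
        rw [hx, SimpleGraph.Walk.length_cons] at hp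
        omega
      refine Set.mem_biUnion (x := y) ?_ h.symm
      change G.dist v y ≤ n
      rw [G.dist_comm, ← hq]
      exact SimpleGraph.dist_le q

theorem ncard_gball_succ {V : Type*} {G : SimpleGraph V} (hconn : G.Connected)
    (hlf : ∀ x : V, (G.neighborSet x).Finite) (v : V) (n : ℕ) :
    (gball G v (n + 1)).ncard = (gball G v n).ncard + (gsphere G v (n + 1)).ncard := by
  have hfin := gball_finite hconn hlf v (n + 1)
  rw [gball_succ] at hfin ⊢
  exact Set.ncard_union_eq (disjoint_gball_gsphere_succ G v n)
    (hfin.subset Set.subset_union_left) (hfin.subset Set.subset_union_right)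

/-- Let `G` be a connected, locally finite, infinite graph and `v` a
vertex with `|B_v(n)|/n² → 0`. Then for every `0 < ε < 1` there are infinitely many
`n` with `|S_v(n)| ≤ 2n(1-ε)/3`. -/
theorem stmt_17 {V : Type*} [Infinite V] (G : SimpleGraph V) (hconn : G.Connected)
    (hlf : ∀ x : V, (G.neighborSet x).Finite) (v : V)
    (hgrowth : Tendsto
      (fun n : ℕ => ((gball G v n).ncard : ℝ) / (n : ℝ) ^ 2) atTop (nhds 0)) :
    ∀ ε : ℝ, 0 < ε → ε < 1 →
      {n : ℕ | ((gsphere G v n).ncard : ℝ) ≤ 2 * n * (1 - ε) / 3}.Infinite := by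
  intro ε _ hε1 hfin
  obtain ⟨N, hN⟩ := hfin.bddAbove
  set c : ℝ := 2 * (1 - ε) / 3 with hc
  have hcpos : 0 < c := by rw [hc]; linarith
  have hsphere : ∀ n : ℕ, N < n → c * n ≤ (gsphere G v n).ncard := by
    intro n hn
    by_contra! h
    refine hn.not_ge (hN ?_)
    rw [Set.mem_ofPred_eq]
    refine h.le.trans_eq ?_
    rw [hc]
    ring
  have hball : ∀ m k : ℕ, N < m → k * (c * m) ≤ (gball G v (m + k)).ncard := by
    intro m k hm
    induction k with
    | zero => simp
    | succ k ih =>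
      have hS := hsphere (m + k + 1) (by omega)
      rw [← add_assoc, ncard_gball_succ hconn hlf]
      push_cast at hS ⊢
      have : 0 ≤ c * (k + 1) := by positivity
      linarith
  obtain ⟨M, hM⟩ := eventually_atTop.mp (hgrowth.eventually_lt_const (show 0 < c / 4 by positivity))
  have hlt := hM ((M + N + 1) + (M + N + 1)) (by omega)
  have hle := hball (M + N + 1) (M + N + 1) (by omega)
  have hpos : (0 : ℝ) < ((M + N + 1 : ℕ) : ℝ) := by positivity
  rw [Nat.cast_add (M + N + 1), div_lt_iff₀ (by positivity)] at hlt
  linarith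
end
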